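/- arXiv:2001.01419 — 8 statements merged into one kernel-verified Lean document; each statement's English description precedes it below -/
import Mathlib

section
/- Let G be a connected graph and let Γ be an extremal RMC_k-coloring of G, i.e., an RMC_k-coloring of G using exactly rmc_k(G) colors. Then for every color i used by Γ, the subgraph of G induced by the set of edges colored i is a tree. -/
open SimpleGraph

/-- A walk is monochromatic with color `col` under the edge-coloring `c`. -/
def SimpleGraph.Walk.IsMonochromatic {V : Type*} {G : SimpleGraph V} (c : Sym2 V → ℕ)
    {u v : V} (W : G.Walk u v) (col : ℕ) : Prop :=
  ∀ e ∈ W.edges, c e = col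

/-- `c` is a rainbow monochromatic `k`-edge-connection coloring of `G`:
every two distinct vertices are joined by `k` pairwise edge-disjoint monochromatic
paths with pairwise distinct colors. -/
def SimpleGraph.IsRMCColoring {V : Type*} (G : SimpleGraph V) (k : ℕ) (c : Sym2 V → ℕ) : Prop :=
  ∀ u v : V, u ≠ v → ∃ (P : Fin k → G.Walk u v) (col : Fin k → ℕ),
    (∀ i, (P i).IsPath) ∧
    (∀ i, (P i).IsMonochromatic c (col i)) ∧
    (∀ i j, i ≠ j → ∀ e, e ∈ (P i).edges → e ∉ (P j).edges) ∧
    Function.Injective col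

/-- The number of colors used by `c` on the edges of `G`. -/
noncomputable def SimpleGraph.colorsUsed {V : Type*} (G : SimpleGraph V) (c : Sym2 V → ℕ) : ℕ :=
  (c '' G.edgeSet).ncard

/-- `rmc_k(G)`: the maximum number of colors in an RMC_k-coloring of `G` (0 if none exists). -/
noncomputable def SimpleGraph.rmc {V : Type*} (G : SimpleGraph V) (k : ℕ) : ℕ :=
  sSup {t | ∃ c : Sym2 V → ℕ, G.IsRMCColoring k c ∧ G.colorsUsed c = t}

/-- `τ(G) ≥ k`: `G` has `k` pairwise edge-disjoint spanning trees
(Nash-Williams–Tutte). -/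
def SimpleGraph.TauGE {V : Type*} (G : SimpleGraph V) (k : ℕ) : Prop :=
  ∃ T : Fin k → SimpleGraph V, (∀ i, T i ≤ G) ∧ (∀ i, (T i).IsTree) ∧
    ∀ i j, i ≠ j → Disjoint (T i).edgeSet (T j).edgeSet


/-- The graph formed by the edges of `G` colored `i` by `c`. -/
def SimpleGraph.colorClass {V : Type*} (G : SimpleGraph V) (c : Sym2 V → ℕ) (i : ℕ) :
    SimpleGraph V :=
  SimpleGraph.fromEdgeSet {e | e ∈ G.edgeSet ∧ c e = i}

namespace SimpleGraph

variable {V : Type*} {G : SimpleGraph V} {c : Sym2 V → ℕ} {i : ℕ}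

theorem colorClass_adj {u v : V} : (G.colorClass c i).Adj u v ↔ G.Adj u v ∧ c s(u, v) = i := by
  simp only [colorClass, fromEdgeSet_adj, Set.mem_ofPred_eq, mem_edgeSet]
  exact ⟨fun h => h.1, fun h => ⟨h, h.1.ne⟩⟩

theorem mem_edgeSet_colorClass {e : Sym2 V} :
    e ∈ (G.colorClass c i).edgeSet ↔ e ∈ G.edgeSet ∧ c e = i := by
  induction e with
  | _ u v => exact colorClass_adj

theorem colorClass_le : G.colorClass c i ≤ G := fun _ _ h => (colorClass_adj.1 h).1

theorem Walk.IsMonochromatic.reachable_colorClass {u v : V} {W : G.Walk u v}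
    (h : W.IsMonochromatic c i) : (G.colorClass c i).Reachable u v :=
  ⟨W.transfer _ fun e he => mem_edgeSet_colorClass.2 ⟨W.edges_subset_edgeSet he, h e he⟩⟩

theorem Reachable.exists_isPath_isMonochromatic {u v : V}
    (h : (G.colorClass c i).Reachable u v) :
    ∃ W : G.Walk u v, W.IsPath ∧ W.IsMonochromatic c i := by
  obtain ⟨p, hp⟩ := h.exists_isPath
  refine ⟨p.mapLe colorClass_le, hp.mapLe colorClass_le, fun e he => ?_⟩
  rw [Walk.edges_mapLe_eq_edges] at he
  exact (mem_edgeSet_colorClass.1 (p.edges_subset_edgeSet he)).2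

theorem Walk.IsMonochromatic.mem_image {u v : V} {W : G.Walk u v}
    (h : W.IsMonochromatic c i) (huv : u ≠ v) : i ∈ c '' G.edgeSet := by
  cases W with
  | nil => exact absurd rfl huv
  | cons hadj p => exact ⟨_, G.mem_edgeSet.2 hadj, h _ (by simp)⟩

theorem Reachable.of_forall_adj {H K : SimpleGraph V} (h : ∀ x y, H.Adj x y → K.Reachable x y)
    {u v : V} (huv : H.Reachable u v) : K.Reachable u v := by
  obtain ⟨p⟩ := huv
  induction p with
  | nil => exact .rfl
  | cons hadj _ ih => exact (h _ _ hadj).trans ih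

/-- Splitting off a part of a color class into a fresh color preserves the `RMC_k` property as
long as every pair joined in the old class is joined in one of the two new ones. -/
theorem IsRMCColoring.of_split {k m : ℕ} {c' : Sym2 V → ℕ} (hc : G.IsRMCColoring k c)
    (hm : m ∉ c '' G.edgeSet) (hc' : ∀ e, c e ≠ i → c' e = c e)
    (hreach : ∀ u v, (G.colorClass c i).Reachable u v →
      (G.colorClass c' i).Reachable u v ∨ (G.colorClass c' m).Reachable u v) :
    G.IsRMCColoring k c' := by
  intro u v huv
  obtain ⟨P, col, hP, hmono, -, hinj⟩ := hc u v huv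
  have key : ∀ j, ∃ (W : G.Walk u v) (d : ℕ), W.IsPath ∧ W.IsMonochromatic c' d ∧
      (d = col j ∨ d = m ∧ col j = i) := by
    intro j
    by_cases hj : col j = i
    · subst hj
      obtain h | h := hreach u v (hmono j).reachable_colorClass
      · obtain ⟨W, hW, hWm⟩ := h.exists_isPath_isMonochromatic
        exact ⟨W, _, hW, hWm, .inl rfl⟩
      · obtain ⟨W, hW, hWm⟩ := h.exists_isPath_isMonochromatic
        exact ⟨W, _, hW, hWm, .inr ⟨rfl, rfl⟩⟩
    · refine ⟨P j, col j, hP j, fun e he => ?_, .inl rfl⟩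
      have he' := hmono j e he
      rw [hc' e (he' ▸ hj), he']
  choose W d hW hWm hd using key
  have hcol : ∀ j, col j ≠ m := fun j hj => hm (hj ▸ (hmono j).mem_image huv)
  have hdinj : Function.Injective d := by
    intro a b hab
    apply hinj
    have := hcol a
    have := hcol b
    have := hd a
    have := hd b
    grind
  exact ⟨W, d, hW, hWm,
    fun a b hab e ha hb => hab (hdinj ((hWm a e ha).symm.trans (hWm b e hb))), hdinj⟩

theorem colorsUsed_le_rmc [Finite V] {k : ℕ} (hc : G.IsRMCColoring k c) :
    G.colorsUsed c ≤ G.rmc k := by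
  refine le_csSup ⟨G.edgeSet.ncard, ?_⟩ ⟨c, hc, rfl⟩
  rintro _ ⟨d, -, rfl⟩
  exact Set.ncard_image_le (Set.toFinite _)

/-- In an extremal coloring, no color class splits into two nonempty parts such that every
pair joined in the class is joined in one of the parts. -/
theorem IsRMCColoring.not_split_of_extremal [Finite V] {k : ℕ} (hc : G.IsRMCColoring k c)
    (hext : G.colorsUsed c = G.rmc k) {A B : SimpleGraph V}
    (hAB : A ⊔ B = G.colorClass c i) (hdisj : Disjoint A B) (hA : A ≠ ⊥) (hB : B ≠ ⊥)
    (hreach : ∀ u v, (G.colorClass c i).Reachable u v → A.Reachable u v ∨ B.Reachable u v) :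
    False := by
  classical
  have hfin : (c '' G.edgeSet).Finite := Set.toFinite _
  obtain ⟨m, hm⟩ := hfin.exists_notMem
  have hBle : ∀ e ∈ B.edgeSet, e ∈ G.edgeSet ∧ c e = i := fun e he =>
    mem_edgeSet_colorClass.1 (edgeSet_mono (hAB ▸ le_sup_right) he)
  have hAle : ∀ e ∈ A.edgeSet, e ∈ G.edgeSet ∧ c e = i := fun e he =>
    mem_edgeSet_colorClass.1 (edgeSet_mono (hAB ▸ le_sup_left) he)
  have hnot : ∀ e ∈ A.edgeSet, e ∉ B.edgeSet := fun e h h' =>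
    Set.disjoint_left.1 (disjoint_edgeSet.2 hdisj) h h'
  obtain ⟨a, ha⟩ := edgeSet_nonempty.2 hA
  obtain ⟨b, hb⟩ := edgeSet_nonempty.2 hB
  set c' : Sym2 V → ℕ := fun e => if e ∈ B.edgeSet then m else c e with hc'
  have hle1 : A ≤ G.colorClass c' i := fun x y h => by
    have h1 := hAle s(x, y) h
    exact colorClass_adj.2 ⟨h1.1, (if_neg (hnot s(x, y) h)).trans h1.2⟩
  have hle2 : B ≤ G.colorClass c' m := fun x y h =>
    colorClass_adj.2 ⟨(hBle s(x, y) h).1, if_pos h⟩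
  have hrmc : G.IsRMCColoring k c' := by
    refine hc.of_split hm (fun e he => if_neg fun h => he (hBle e h).2) fun u v h => ?_
    exact (hreach u v h).imp (·.mono hle1) (·.mono hle2)
  have hsub : insert m (c '' G.edgeSet) ⊆ c' '' G.edgeSet := by
    rw [Set.insert_subset_iff]
    refine ⟨⟨b, (hBle b hb).1, if_pos hb⟩, ?_⟩
    rintro _ ⟨e, he, rfl⟩
    by_cases h : e ∈ B.edgeSet
    · exact ⟨a, (hAle a ha).1, (if_neg (hnot a ha)).trans ((hAle a ha).2.trans (hBle e h).2.symm)⟩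
    · exact ⟨e, he, if_neg h⟩
  have hcard := Set.ncard_le_ncard hsub (Set.toFinite _)
  rw [Set.ncard_insert_of_notMem hm hfin] at hcard
  have := colorsUsed_le_rmc hrmc
  unfold colorsUsed at *
  omega

theorem IsRMCColoring.isAcyclic_colorClass [Finite V] {k : ℕ} (hc : G.IsRMCColoring k c)
    (hext : G.colorsUsed c = G.rmc k) : (G.colorClass c i).IsAcyclic := by
  rw [isAcyclic_iff_forall_adj_isBridge]
  intro x y hxy
  by_contra hbr
  have hreach : ((G.colorClass c i).deleteEdges {s(x, y)}).Reachable x y := by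
    rw [isBridge_iff] at hbr
    tauto
  refine hc.not_split_of_extremal hext (A := (G.colorClass c i).deleteEdges {s(x, y)})
    (B := fromEdgeSet {s(x, y)}) (i := i) ?_ ?_ ?_ ?_ fun u v h => .inl (h.of_forall_adj fun a b hab => ?_)
  · ext a b
    simp only [sup_adj, deleteEdges_adj, fromEdgeSet_adj, Set.mem_singleton_iff]
    constructor
    · rintro (h | ⟨h, -⟩)
      · exact h.1
      · rw [← mem_edgeSet, h]
        exact hxy
    · intro h
      have := h.ne
      tauto
  · rw [← disjoint_edgeSet, Set.disjoint_left]
    simp +contextual [edgeSet_deleteEdges]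
  · intro h
    rw [h, reachable_bot] at hreach
    exact hxy.ne hreach
  · intro h
    have : (fromEdgeSet {s(x, y)}).Adj x y := by simpa using hxy.ne
    simp [h] at this
  · by_cases h : s(a, b) = s(x, y)
    · obtain ⟨rfl, rfl⟩ | ⟨rfl, rfl⟩ := Sym2.eq_iff.1 h
      · exact hreach
      · exact hreach.symm
    · exact Adj.reachable (deleteEdges_adj.2 ⟨hab, h⟩)

theorem IsRMCColoring.reachable_colorClass [Finite V] {k : ℕ} (hc : G.IsRMCColoring k c)
    (hext : G.colorsUsed c = G.rmc k) {u v : V} (hu : u ∈ (G.colorClass c i).support)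
    (hv : v ∈ (G.colorClass c i).support) : (G.colorClass c i).Reachable u v := by
  by_contra huv
  set H := G.colorClass c i
  let A : SimpleGraph V :=
    { Adj x y := H.Adj x y ∧ H.Reachable u x
      symm := ⟨fun _ _ h => ⟨h.1.symm, h.2.trans h.1.reachable⟩⟩
      loopless := ⟨fun _ h => h.1.ne rfl⟩ }
  let B : SimpleGraph V :=
    { Adj x y := H.Adj x y ∧ ¬ H.Reachable u x
      symm := ⟨fun _ _ h => ⟨h.1.symm, fun h' => h.2 (h'.trans h.1.symm.reachable)⟩⟩
      loopless := ⟨fun _ h => h.1.ne rfl⟩ }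
  obtain ⟨u', hu'⟩ := hu
  obtain ⟨v', hv'⟩ := hv
  refine hc.not_split_of_extremal hext (A := A) (B := B) (i := i) ?_ ?_ ?_ ?_ fun x y h => ?_
  · ext x y
    change (H.Adj x y ∧ _ ∨ H.Adj x y ∧ _) ↔ H.Adj x y
    tauto
  · rw [disjoint_left]
    exact fun x y h h' => h'.2 h.2
  · intro h
    have : A.Adj u u' := ⟨hu', .rfl⟩
    simp [h] at this
  · intro h
    have : B.Adj v v' := ⟨hv', huv⟩
    simp [h] at this
  · obtain ⟨p⟩ := h
    by_cases hx : H.Reachable u x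
    · left
      induction p with
      | nil => exact .rfl
      | cons hadj _ ih =>
        exact (Adj.reachable (G := A) ⟨hadj, hx⟩).trans (ih (hx.trans hadj.reachable))
    · right
      induction p with
      | nil => exact .rfl
      | cons hadj _ ih =>
        exact (Adj.reachable (G := B) ⟨hadj, hx⟩).trans
          (ih fun h => hx (h.trans hadj.symm.reachable))

end SimpleGraph

/-- If `Γ` is an extremal RMC_k-coloring of a connected graph `G` (i.e. it uses
exactly `rmc_k(G)` colors), then for every color `i` used by `Γ`, the subgraph
induced by the edges colored `i` is a tree: it is acyclic and any two vertices
incident with an edge of color `i` are joined in it. -/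
theorem colorClass_isTree_of_extremal {V : Type*} [Fintype V] (G : SimpleGraph V)
    (hG : G.Connected) (k : ℕ) (Γ : Sym2 V → ℕ)
    (h1 : G.IsRMCColoring k Γ) (h2 : G.colorsUsed Γ = G.rmc k) :
    ∀ i ∈ Γ '' G.edgeSet,
      (SimpleGraph.fromEdgeSet {e | e ∈ G.edgeSet ∧ Γ e = i}).IsAcyclic ∧
      ∀ u v : V, u ∈ (SimpleGraph.fromEdgeSet {e | e ∈ G.edgeSet ∧ Γ e = i}).support →
        v ∈ (SimpleGraph.fromEdgeSet {e | e ∈ G.edgeSet ∧ Γ e = i}).support →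
        (SimpleGraph.fromEdgeSet {e | e ∈ G.edgeSet ∧ Γ e = i}).Reachable u v := by
  exact fun i _ => ⟨h1.isAcyclic_colorClass h2, fun u v hu hv => h1.reachable_colorClass h2 hu hv⟩
end

section
/- Let D, n, s, r be integers with n ≥ 5, 1 ≤ s ≤ n−4, and D < r·C(n−s,2). For a sequence x = (x_1,…,x_t) with each x_i ∈ {3,4,…,n−s}, set f(x) = Σ_{i=1}^t C(x_i−1,2) and g(x) = Σ_{i=1}^t (x_i−2), and for each length t let S_t be the set of sequences of length t minimizing g subject to f(x) ≥ D and x_i ∈ {3,…,n−s}. Then for any integer t ≥ r, any a ∈ S_t, and any b ∈ S_r, one has g(b) ≤ g(a). -/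
/-- `a` is a feasible sequence: all entries in `{3, …, n-s}` and
`f(a) = Σᵢ C(aᵢ-1, 2) ≥ D`. -/
def Feasible (n s : ℕ) (D : ℤ) {t : ℕ} (a : Fin t → ℕ) : Prop :=
  (∀ i, 3 ≤ a i ∧ a i ≤ n - s) ∧ D ≤ ∑ i, ((a i - 1).choose 2 : ℤ)

/-- `g(a) = Σᵢ (aᵢ - 2)`. -/
def gVal {t : ℕ} (a : Fin t → ℕ) : ℕ := ∑ i, (a i - 2)

/-- `S_t`: the set of feasible sequences of length `t` minimizing `g`. -/
def OptSet (n s : ℕ) (D : ℤ) (t : ℕ) : Set (Fin t → ℕ) :=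
  {a | Feasible n s D a ∧ ∀ b : Fin t → ℕ, Feasible n s D b → gVal a ≤ gVal b}

/-- Raising the entries of a family bounded below by `k` by `c` units in total increases the sum of
the triangular numbers by at least `c * (k + 1)`. -/
theorem exists_sum_eq_add_of_le {ι : Type*} [Fintype ι] (w : ι → ℕ) (k m : ℕ)
    (hk : ∀ i, k ≤ w i) (hm : ∀ i, w i ≤ m) (c : ℕ)
    (hc : ∑ i, w i + c ≤ Fintype.card ι * m) :
    ∃ z : ι → ℕ, (∀ i, k ≤ z i ∧ z i ≤ m) ∧ ∑ i, z i = ∑ i, w i + c ∧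
      ∑ i, (w i + 1).choose 2 + c * (k + 1) ≤ ∑ i, (z i + 1).choose 2 := by
  classical
  induction c with
  | zero => exact ⟨w, fun i => ⟨hk i, hm i⟩, by simp, by simp⟩
  | succ c ih =>
    obtain ⟨z, hz, hsum, hf⟩ := ih (by omega)
    obtain ⟨j, hj⟩ : ∃ j, z j < m := by
      by_contra! h
      have : ∑ _i : ι, m ≤ ∑ i, z i := Finset.sum_le_sum fun i _ => h i
      simp only [Finset.sum_const, Finset.card_univ, smul_eq_mul] at this
      omega
    have hupd (F : ℕ → ℕ) : ∑ i, F (Function.update z j (z j + 1) i) + F (z j) =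
        ∑ i, F (z i) + F (z j + 1) := by
      rw [← Finset.add_sum_erase _ _ (Finset.mem_univ j),
        ← Finset.add_sum_erase _ (fun i => F (z i)) (Finset.mem_univ j),
        Finset.sum_congr rfl (g := fun i => F (z i)) fun i hi => by
          rw [Function.update_of_ne (Finset.ne_of_mem_erase hi)]]
      simp only [Function.update_self]
      ring
    refine ⟨Function.update z j (z j + 1), fun i => ?_, ?_, ?_⟩
    · rcases eq_or_ne i j with rfl | hij
      · have := hz i
        simp only [Function.update_self]
        omega
      · simpa [Function.update_of_ne hij] using hz i
    · have := hupd id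
      simp only [id] at this
      omega
    · have h := hupd fun x => (x + 1).choose 2
      have hchoose : (z j + 1 + 1).choose 2 = (z j + 1) + (z j + 1).choose 2 := by
        rw [Nat.choose_succ_succ' (z j + 1) 1, Nat.choose_one_right]
      have := (hz j).1
      rw [add_one_mul]
      omega

/-- A feasible sequence can be shortened by one entry without increasing `g`, as long as the
constant sequence of largest entries of the shorter length is feasible. -/
theorem Feasible.exists_shorter {n s : ℕ} {D : ℤ} {t : ℕ} (hns : 3 ≤ n - s)
    (hD : D ≤ t * ((n - s - 1).choose 2 : ℤ)) {a : Fin (t + 1) → ℕ} (ha : Feasible n s D a) :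
    ∃ b : Fin t → ℕ, Feasible n s D b ∧ gVal b ≤ gVal a := by
  obtain ⟨hbd, hDa⟩ := ha
  rcases le_total (gVal a) (t * (n - s - 2)) with hg | hg
  · obtain ⟨j, -, hj⟩ := Finset.exists_min_image Finset.univ a Finset.univ_nonempty
    have hsplit : gVal a = (a j - 2) + ∑ i : Fin t, (a (j.succAbove i) - 2) :=
      Fin.sum_univ_succAbove _ j
    obtain ⟨z, hz, hsum, hf⟩ := exists_sum_eq_add_of_le (fun i : Fin t => a (j.succAbove i) - 2)
      (a j - 2) (n - s - 2) (fun i => Nat.sub_le_sub_right (hj _ (Finset.mem_univ _)) 2)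
      (fun i => Nat.sub_le_sub_right (hbd _).2 2) (a j - 2)
      (by rw [Fintype.card_fin]; omega)
    refine ⟨fun i => z i + 2, ⟨fun i => ?_, ?_⟩, ?_⟩
    · have := hz i
      have := hbd j
      dsimp only
      omega
    · refine hDa.trans ?_
      rw [Fin.sum_univ_succAbove _ j]
      have hshift (i : Fin t) : a (j.succAbove i) - 2 + 1 = a (j.succAbove i) - 1 := by
        have := hbd (j.succAbove i)
        omega
      simp only [hshift] at hf
      have hle : (a j - 1).choose 2 ≤ (a j - 2) * (a j - 2 + 1) := by
        have := (hbd j).1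
        rw [Nat.choose_two_right, show a j - 2 + 1 = a j - 1 by omega,
          show a j - 1 - 1 = a j - 2 by omega, mul_comm]
        exact Nat.div_le_self _ _
      norm_cast
      simp only [Nat.add_succ_sub_one]
      omega
    · simp only [gVal, Nat.add_sub_cancel] at hsplit ⊢
      omega
  · refine ⟨fun _ => n - s, ⟨fun _ => ⟨hns, le_rfl⟩, by simpa using hD⟩, ?_⟩
    simpa [gVal] using hg

/-- A feasible sequence can be shortened to any length `r` at which some sequence is feasible,
without increasing `g`. -/
theorem Feasible.exists_of_le {n s : ℕ} {D : ℤ} {r t : ℕ} (hns : 3 ≤ n - s)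
    (hD : D ≤ r * ((n - s - 1).choose 2 : ℤ)) (hrt : r ≤ t) {a : Fin t → ℕ}
    (ha : Feasible n s D a) :
    ∃ b : Fin r → ℕ, Feasible n s D b ∧ gVal b ≤ gVal a := by
  induction t, hrt using Nat.le_induction with
  | base => exact ⟨a, ha, le_rfl⟩
  | succ t hrt ih =>
    obtain ⟨b, hb, hba⟩ := ha.exists_shorter hns (hD.trans (by gcongr))
    obtain ⟨c, hc, hcb⟩ := ih hb
    exact ⟨c, hc, hcb.trans hba⟩

/-- The constant sequence of largest entries maximizes `f`. -/
theorem Feasible.le_mul_choose {n s : ℕ} {D : ℤ} {t : ℕ} {a : Fin t → ℕ}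
    (ha : Feasible n s D a) : D ≤ t * ((n - s - 1).choose 2 : ℤ) := by
  refine ha.2.trans ((Finset.sum_le_sum (g := fun _ => ((n - s - 1).choose 2 : ℤ))
    fun i _ => ?_).trans_eq ?_)
  · exact_mod_cast Nat.choose_le_choose 2 (Nat.sub_le_sub_right (ha.1 i).2 1)
  · simp

/-- Lemma 2.2: if `t ≥ r`, `a ∈ S_t` and `b ∈ S_r`, then `g(b) ≤ g(a)`. -/
theorem gVal_optSet_mono (D : ℤ) (n s r t : ℕ) (hn : 5 ≤ n) (hs1 : 1 ≤ s) (hs2 : s ≤ n - 4)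
    (hD : D < (r : ℤ) * ((n - s).choose 2 : ℤ)) (hrt : r ≤ t)
    (a : Fin t → ℕ) (ha : a ∈ OptSet n s D t)
    (b : Fin r → ℕ) (hb : b ∈ OptSet n s D r) :
    gVal b ≤ gVal a := by
  obtain ⟨c, hc, hca⟩ := ha.1.exists_of_le (by omega) hb.1.le_mul_choose hrt
  exact (hb.2 c hc).trans hca
end

section
/- Let G be a simple graph, k ≥ 2 an integer, and Γ an RMC_k-coloring of G. Then every vertex v of G satisfies d^n(v) ≥ k, where d^n(v) is the number of nontrivial colors appearing on edges incident with v. -/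
open SimpleGraph

/-- A color `i` is nontrivial if at least two edges of `G` receive it. -/
def SimpleGraph.NontrivialColor {V : Type*} (G : SimpleGraph V) (c : Sym2 V → ℕ) (i : ℕ) : Prop :=
  1 < {e ∈ G.edgeSet | c e = i}.ncard

/-- `d^n(v)`: the number of nontrivial colors on the edges incident with `v`. -/
noncomputable def SimpleGraph.ntColorDegree {V : Type*} (G : SimpleGraph V)
    (c : Sym2 V → ℕ) (v : V) : ℕ :=
  {i : ℕ | G.NontrivialColor c i ∧ ∃ e ∈ G.edgeSet, v ∈ e ∧ c e = i}.ncard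

/-- A monochromatic path leaving `v` whose color is not a nontrivial color at `v` is a single
edge. -/
theorem SimpleGraph.Walk.IsMonochromatic.mem_edges_of_notMem {V : Type*} [Finite V]
    {G : SimpleGraph V} {c : Sym2 V → ℕ} {v u : V} {W : G.Walk v u} {col : ℕ}
    (hW : W.IsPath) (hm : W.IsMonochromatic c col) (hvu : v ≠ u)
    (hcol : ¬ (G.NontrivialColor c col ∧ ∃ e ∈ G.edgeSet, v ∈ e ∧ c e = col)) :
    s(v, u) ∈ W.edges := by
  cases W with
  | nil => exact absurd rfl hvu
  | @cons _ w _ hvw p =>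
    cases p with
    | nil => simp
    | @cons _ x _ hwx q =>
      refine absurd ⟨?_, s(v, w), hvw, Sym2.mem_mk_left v w, hm _ (by simp)⟩ hcol
      refine (Set.one_lt_ncard (Set.toFinite _)).2
        ⟨s(v, w), ⟨hvw, hm _ (by simp)⟩, s(w, x), ⟨hwx, hm _ (by simp)⟩, fun h => ?_⟩
      have hnodup := hW.isTrail.edges_nodup
      simp [h] at hnodup

/-- If `Γ` is an RMC_k-coloring of a (nontrivial) simple graph `G` with `k ≥ 2`,
then every vertex `v` satisfies `d^n(v) ≥ k`. -/
theorem ntColorDegree_ge {V : Type*} [Fintype V] [Nontrivial V] (G : SimpleGraph V) (k : ℕ)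
    (hk : 2 ≤ k) (Γ : Sym2 V → ℕ) (hΓ : G.IsRMCColoring k Γ) :
    ∀ v : V, k ≤ G.ntColorDegree Γ v := by
  intro v
  by_contra! hlt
  let N : Set ℕ := {i | G.NontrivialColor Γ i ∧ ∃ e ∈ G.edgeSet, v ∈ e ∧ Γ e = i}
  have hfin : N.Finite :=
    (Set.finite_range Γ).subset fun _ ⟨_, e, _, _, he⟩ => ⟨e, he⟩
  have hedge : ∀ u, v ≠ u → Γ s(v, u) ∉ N := by
    intro u hvu
    obtain ⟨P, col, hP, hm, -, hinj⟩ := hΓ v u hvu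
    obtain ⟨i, hi⟩ : ∃ i, col i ∉ N := by
      by_contra! hall
      have hle := Set.ncard_le_ncard (Set.range_subset_iff.2 hall) hfin
      rw [← Set.image_univ, Set.ncard_image_of_injective _ hinj, Set.ncard_univ,
        Nat.card_fin] at hle
      exact absurd hle (not_le.2 hlt)
    rwa [hm i _ ((hm i).mem_edges_of_notMem (hP i) hvu hi)]
  have hempty : ∀ i, i ∉ N := by
    rintro i hi
    obtain ⟨-, e, he, hve, rfl⟩ := id hi
    obtain ⟨w, rfl⟩ := hve
    exact hedge w (G.ne_of_adj he) hi
  obtain ⟨u, huv⟩ := exists_ne v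
  obtain ⟨P, col, hP, hm, hdisj, -⟩ := hΓ v u huv.symm
  have hmem : ∀ i, s(v, u) ∈ (P i).edges := fun i =>
    (hm i).mem_edges_of_notMem (hP i) huv.symm (hempty _)
  exact hdisj ⟨0, by omega⟩ ⟨1, by omega⟩ (by simp) _ (hmem _) (hmem _)
end

section
/- Let G be a loopless multigraph (parallel edges are allowed, loops are not) and k a positive integer. Then G has an RMC_k-coloring if and only if τ(G) ≥ k, equivalently, if and only if G contains k pairwise edge-disjoint spanning trees. -/
/-- A loopless multigraph on vertex type `V` with edge type `E`: every edge has
two distinct endpoints, and parallel edges are allowed. -/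
structure Multigraph (V E : Type*) where
  ends : E → Sym2 V
  loopless : ∀ e, ¬ (ends e).IsDiag

namespace Multigraph

variable {V E : Type*}

/-- A walk in a multigraph, recorded with the edges it traverses. -/
inductive Walk (G : Multigraph V E) : V → V → Type _
  | nil (v : V) : Walk G v v
  | cons {u w x : V} (e : E) (he : G.ends e = s(u, w)) (p : Walk G w x) : Walk G u x

/-- The list of edges of a walk. -/
def Walk.edges {G : Multigraph V E} : ∀ {u v : V}, Walk G u v → List E
  | _, _, .nil _ => []
  | _, _, .cons e _ p => e :: p.edges

/-- The list of vertices visited by a walk. -/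
def Walk.vertices {G : Multigraph V E} : ∀ {u v : V}, Walk G u v → List V
  | u, _, .nil _ => [u]
  | u, _, .cons _ _ p => u :: p.vertices

/-- A walk is a path if it visits no vertex twice. -/
def Walk.IsPath {G : Multigraph V E} {u v : V} (W : Walk G u v) : Prop :=
  W.vertices.Nodup

/-- `c` is a rainbow monochromatic `k`-edge-connection coloring of the
multigraph `G`: every two distinct vertices are joined by `k` pairwise
edge-disjoint monochromatic paths with pairwise distinct colors. -/
def IsRMCColoring (G : Multigraph V E) (k : ℕ) (c : E → ℕ) : Prop :=
  ∀ u v : V, u ≠ v → ∃ (P : Fin k → Walk G u v) (col : Fin k → ℕ),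
    (∀ i, (P i).IsPath) ∧
    (∀ i, ∀ e ∈ (P i).edges, c e = col i) ∧
    (∀ i j, i ≠ j → ∀ e, e ∈ (P i).edges → e ∉ (P j).edges) ∧
    Function.Injective col

/-- `T ⊆ E` is (the edge set of) a spanning tree of `G`: using only edges of
`T` every two vertices are joined by a walk, and `|T| = n - 1`. -/
def IsSpanningTree (G : Multigraph V E) [Fintype V] (T : Set E) : Prop :=
  (∀ u v : V, ∃ W : Walk G u v, ∀ e ∈ W.edges, e ∈ T) ∧
  T.ncard = Fintype.card V - 1

/-- `G` contains `k` pairwise edge-disjoint spanning trees. -/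
def HasEdgeDisjointSpanningTrees (G : Multigraph V E) [Fintype V] (k : ℕ) : Prop :=
  ∃ T : Fin k → Set E, (∀ i, G.IsSpanningTree (T i)) ∧
    ∀ i j, i ≠ j → Disjoint (T i) (T j)

/-- `τ(G) ≥ k`: for every partition of `V(G)` into `t ≥ 2` parts (given by a
surjection onto `Fin t`), the number of edges joining distinct parts is at
least `k(t - 1)` (Nash-Williams–Tutte condition). -/
def TauGE (G : Multigraph V E) (k : ℕ) : Prop :=
  ∀ (t : ℕ) (f : V → Fin t), 2 ≤ t → Function.Surjective f →
    k * (t - 1) ≤ {e : E | ¬ (Sym2.map f (G.ends e)).IsDiag}.ncard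

end Multigraph

/-- The space of rational functions on the vertices which are constant along edges of `H`. -/
def SimpleGraph.locallyConstant {V : Type*} (H : SimpleGraph V) : Submodule ℚ (V → ℚ) where
  carrier := {φ | ∀ u v, H.Adj u v → φ u = φ v}
  add_mem' := fun ha hb u v h => by simp [ha u v h, hb u v h]
  zero_mem' := fun _ _ _ => rfl
  smul_mem' := fun c φ ha u v h => by simp [ha u v h]

/-- The indicators of the connected components form a basis of `H.locallyConstant`. -/
theorem SimpleGraph.finrank_locallyConstant {V : Type*} [Finite V] (H : SimpleGraph V) :
    Module.finrank ℚ H.locallyConstant = Nat.card H.ConnectedComponent := by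
  classical
  have := Fintype.ofFinite V
  have := Fintype.ofFinite H.ConnectedComponent
  let L := LinearMap.funLeft ℚ ℚ H.connectedComponentMk
  have hL : Function.Injective L :=
    LinearMap.funLeft_injective_of_surjective _ _ _ Quot.mk_surjective
  have hrange : H.locallyConstant = LinearMap.range L := by
    ext φ
    constructor
    · intro hφ
      have hreach : ∀ u v, H.Walk u v → φ u = φ v := by
        intro u v w
        induction w with
        | nil => rfl
        | cons h _ ih => exact (hφ _ _ h).trans ih
      refine ⟨Quot.lift φ fun u v h => hreach u v h.some, rfl⟩
    · rintro ⟨ψ, rfl⟩ u v h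
      exact congrArg ψ (SimpleGraph.ConnectedComponent.sound h.reachable)
  rw [hrange, LinearMap.finrank_range_of_inj hL, Module.finrank_fintype_fun_eq_card,
    Nat.card_eq_fintype_card]

/-- The number of connected components is supermodular. -/
theorem SimpleGraph.card_connectedComponent_add_le {V : Type*} [Finite V]
    {H₁ H₂ M : SimpleGraph V} (h₁ : M ≤ H₁) (h₂ : M ≤ H₂) :
    Nat.card H₁.ConnectedComponent + Nat.card H₂.ConnectedComponent ≤
      Nat.card (H₁ ⊔ H₂).ConnectedComponent + Nat.card M.ConnectedComponent := by
  simp only [← finrank_locallyConstant]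
  rw [← Submodule.finrank_sup_add_finrank_inf_eq, add_comm]
  refine add_le_add (Submodule.finrank_mono ?_) (Submodule.finrank_mono ?_)
  · rintro φ ⟨ha, hb⟩ u v (h | h)
    exacts [ha u v h, hb u v h]
  · exact sup_le (fun φ hφ u v h => hφ u v (h₁ h)) (fun φ hφ u v h => hφ u v (h₂ h))

/-- Adding edges does not increase the number of connected components. -/
theorem SimpleGraph.card_connectedComponent_anti {V : Type*} [Finite V]
    {H₁ H₂ : SimpleGraph V} (h : H₁ ≤ H₂) :
    Nat.card H₂.ConnectedComponent ≤ Nat.card H₁.ConnectedComponent := by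
  simp only [← finrank_locallyConstant]
  exact Submodule.finrank_mono fun φ hφ u v huv => hφ u v (h huv)

/-- A packing theorem in the style of Rado: antitone supermodular set functions `κ i` with
`∑ i, κ i A ≤ |Aᶜ| + N` for every `A` admit pairwise disjoint sets `F i` with
`∑ i, κ i (F i) ≤ N`. -/
theorem exists_pairwise_disjoint_sum_le {ι E : Type*} [Fintype ι] [Fintype E] [DecidableEq E]
    (κ : ι → Finset E → ℕ) (hanti : ∀ i, Antitone (κ i))
    (hsup : ∀ i X Y, κ i X + κ i Y ≤ κ i (X ∪ Y) + κ i (X ∩ Y)) (N : ℕ)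
    (hN : ∀ A : Finset E, ∑ i, κ i A ≤ Aᶜ.card + N) :
    ∃ F : ι → Finset E, (∀ i j, i ≠ j → Disjoint (F i) (F j)) ∧ ∑ i, κ i (F i) ≤ N := by
  classical
  let S : Set (ι → Finset E) := {F | ∀ A, ∑ i, κ i (A ∩ F i) ≤ Aᶜ.card + N}
  have hS : S.Nonempty := ⟨fun _ => Finset.univ, fun A => by simpa using hN A⟩
  obtain ⟨F, hF, hmin⟩ := S.toFinite.exists_minimal hS
  refine ⟨F, fun i j hij => ?_, by simpa using hF Finset.univ⟩
  rw [Finset.disjoint_left]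
  intro e hei hej
  have key : ∀ l, e ∈ F l → ∃ A, e ∈ A ∧
      Aᶜ.card + N < ∑ m, κ m (A ∩ Function.update F l ((F l).erase e) m) := by
    intro l hel
    have hlt : Function.update F l ((F l).erase e) < F :=
      update_lt_self_iff.2 (Finset.erase_ssubset hel)
    have hnot : Function.update F l ((F l).erase e) ∉ S := fun h => (hmin h hlt.le).not_gt hlt
    simp only [S, Set.mem_ofPred_eq, not_forall, not_le] at hnot
    obtain ⟨A, hA⟩ := hnot
    refine ⟨A, ?_, hA⟩
    by_contra heA
    refine (hA.trans_le ?_).not_ge (hF A)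
    refine Finset.sum_le_sum fun m _ => hanti m ?_
    intro x hx
    by_cases hm : m = l
    · subst hm
      simp only [Finset.mem_inter, Function.update_self, Finset.mem_erase] at hx ⊢
      exact ⟨hx.1, fun h => heA (h ▸ hx.1), hx.2⟩
    · simpa [hm] using hx
  obtain ⟨A, heA, hA⟩ := key i hei
  obtain ⟨B, heB, hB⟩ := key j hej
  have hterm : ∀ m, κ m (A ∩ Function.update F i ((F i).erase e) m) +
      κ m (B ∩ Function.update F j ((F j).erase e) m) ≤
      κ m ((A ∪ B) ∩ F m) + κ m ((A ∩ B).erase e ∩ F m) := by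
    intro m
    refine (hsup m _ _).trans (add_le_add (hanti m ?_) (hanti m ?_))
    all_goals
      intro x hx
      by_cases hmi : m = i
      · subst hmi
        simp only [Finset.mem_inter, Finset.mem_union, Finset.mem_erase, Function.update_self,
          Function.update_of_ne hij] at hx ⊢
        grind
      · by_cases hmj : m = j
        · subst hmj
          simp only [Finset.mem_inter, Finset.mem_union, Finset.mem_erase, Function.update_self,
            Function.update_of_ne hij.symm] at hx ⊢
          grind
        · simp only [Finset.mem_inter, Finset.mem_union, Finset.mem_erase,
            Function.update_of_ne hmi, Function.update_of_ne hmj] at hx ⊢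
          grind
  have hsum := Finset.sum_le_sum fun m (_ : m ∈ Finset.univ) => hterm m
  simp only [Finset.sum_add_distrib] at hsum
  have h₁ := hF (A ∪ B)
  have h₂ := hF ((A ∩ B).erase e)
  have hcard := Finset.card_union_add_card_inter A B
  have herase := Finset.card_erase_add_one (Finset.mem_inter.2 ⟨heA, heB⟩)
  have hc : ∀ X : Finset E, X.card + Xᶜ.card = Fintype.card E := Finset.card_add_card_compl
  have := hc A
  have := hc B
  have := hc (A ∪ B)
  have := hc ((A ∩ B).erase e)
  omega

/-- In a finite family of edges realizing the adjacencies of a graph `H`, there are at least as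
many edges as vertices other than `r` reachable from `r`. -/
theorem SimpleGraph.ncard_reachable_le {V E : Type*} [Finite E] (H : SimpleGraph V) (r : V)
    (ends : E → Sym2 V) (S : Set E)
    (hS : ∀ u v, H.Adj u v → ∃ e ∈ S, ends e = s(u, v)) :
    {v | v ≠ r ∧ H.Reachable r v}.ncard ≤ S.ncard := by
  have hpred : ∀ v ∈ {v | v ≠ r ∧ H.Reachable r v}, ∃ e ∈ S, ∃ w, ends e = s(w, v) ∧
      H.dist r w < H.dist r v := by
    rintro v ⟨hne, hreach⟩
    obtain ⟨p, hp⟩ := hreach.symm.exists_walk_length_eq_dist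
    cases p with
    | nil => exact absurd rfl hne
    | @cons _ w _ h p =>
      obtain ⟨e, he, hends⟩ := hS _ _ h.symm
      refine ⟨e, he, w, hends, ?_⟩
      rw [SimpleGraph.dist_comm (v := w), SimpleGraph.dist_comm (v := v), ← hp]
      exact Nat.lt_succ_of_le (SimpleGraph.dist_le p)
  rcases Set.eq_empty_or_nonempty {v | v ≠ r ∧ H.Reachable r v} with h | ⟨v₀, hv₀⟩
  · simp [h]
  have : Nonempty E := ⟨(hpred v₀ hv₀).choose⟩
  choose! g hgS w hw hdist using hpred
  refine Set.ncard_le_ncard_of_injOn g (fun v hv => hgS v hv) ?_ S.toFinite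
  intro u hu v hv huv
  have h := hw u hu
  rw [huv, hw v hv, Sym2.eq_iff] at h
  rcases h with ⟨-, h⟩ | ⟨h, h'⟩
  · exact h.symm
  · have h₁ := hdist u hu
    have h₂ := hdist v hv
    rw [h] at h₂
    rw [← h'] at h₁
    omega

namespace Multigraph

variable {V E : Type*} {G : Multigraph V E}

/-- The simple graph of adjacencies realized by the edges in `A`. -/
def toSimple (G : Multigraph V E) (A : Set E) : SimpleGraph V where
  Adj u v := ∃ e ∈ A, G.ends e = s(u, v)
  symm := ⟨fun u v ⟨e, he, h⟩ => ⟨e, he, h.trans Sym2.eq_swap⟩⟩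
  loopless := ⟨fun u ⟨e, _, h⟩ => G.loopless e (by rw [h]; exact Sym2.mk_isDiag_iff.2 rfl)⟩

theorem toSimple_mono {A B : Set E} (h : A ⊆ B) : G.toSimple A ≤ G.toSimple B :=
  fun _ _ ⟨e, he, hends⟩ => ⟨e, h he, hends⟩

theorem toSimple_union (A B : Set E) : G.toSimple (A ∪ B) = G.toSimple A ⊔ G.toSimple B := by
  refine le_antisymm ?_ (sup_le (toSimple_mono Set.subset_union_left)
    (toSimple_mono Set.subset_union_right))
  rintro u v ⟨e, he | he, hends⟩
  exacts [Or.inl ⟨e, he, hends⟩, Or.inr ⟨e, he, hends⟩]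

theorem exists_walk_of_reachable {A : Set E} {u v : V} (h : (G.toSimple A).Reachable u v) :
    ∃ W : Walk G u v, ∀ e ∈ W.edges, e ∈ A := by
  obtain ⟨p⟩ := h
  induction p with
  | nil => exact ⟨.nil _, by simp [Walk.edges]⟩
  | cons h _ ih =>
    obtain ⟨e, he, hends⟩ := h
    obtain ⟨W, hW⟩ := ih
    exact ⟨.cons e hends W, by simpa [Walk.edges, he] using hW⟩

/-- The part of a walk after a visited vertex. -/
theorem Walk.exists_suffix {u v x : V} (W : Walk G u v) (hx : x ∈ W.vertices) :
    ∃ W' : Walk G x v, W'.vertices <:+ W.vertices ∧ W'.edges ⊆ W.edges := by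
  induction W with
  | nil =>
    obtain rfl : x = _ := by simpa [Walk.vertices] using hx
    exact ⟨.nil _, List.suffix_refl _, List.Subset.refl _⟩
  | @cons a _ _ e he p ih =>
    by_cases hxa : x = a
    · subst hxa
      exact ⟨.cons e he p, List.suffix_refl _, List.Subset.refl _⟩
    · obtain ⟨W', h₁, h₂⟩ := ih (by simpa [Walk.vertices, hxa] using hx)
      exact ⟨W', h₁.trans (List.suffix_cons _ _), List.subset_cons_of_subset _ h₂⟩

theorem Walk.exists_isPath {u v : V} (W : Walk G u v) :
    ∃ P : Walk G u v, P.IsPath ∧ P.edges ⊆ W.edges := by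
  induction W with
  | nil => exact ⟨.nil _, by simp [Walk.IsPath, Walk.vertices], List.Subset.refl _⟩
  | @cons a _ _ e he p ih =>
    obtain ⟨P, hP, hsub⟩ := ih
    by_cases ha : a ∈ P.vertices
    · obtain ⟨P', h₁, h₂⟩ := P.exists_suffix ha
      exact ⟨P', hP.sublist h₁.sublist,
        List.subset_cons_of_subset _ (List.Subset.trans h₂ hsub)⟩
    · exact ⟨.cons e he P, List.nodup_cons.2 ⟨ha, hP⟩, List.cons_subset_cons _ hsub⟩

theorem HasEdgeDisjointSpanningTrees.exists_isRMCColoring [Fintype V] {k : ℕ}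
    (h : G.HasEdgeDisjointSpanningTrees k) : ∃ c : E → ℕ, G.IsRMCColoring k c := by
  classical
  obtain ⟨T, hT, hdisj⟩ := h
  let c : E → ℕ := fun e => if h : ∃ i, e ∈ T i then (h.choose : ℕ) else 0
  have hc : ∀ i, ∀ e ∈ T i, c e = i := by
    intro i e he
    have hex : ∃ i, e ∈ T i := ⟨i, he⟩
    have heq : hex.choose = i := by
      by_contra hne
      exact Set.disjoint_left.1 (hdisj _ _ hne) hex.choose_spec he
    simp only [c, dif_pos hex, heq]
  refine ⟨c, fun u v _ => ?_⟩
  have hpath : ∀ i, ∃ P : Walk G u v, P.IsPath ∧ ∀ e ∈ P.edges, e ∈ T i := by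
    intro i
    obtain ⟨W, hW⟩ := (hT i).1 u v
    obtain ⟨P, hP, hsub⟩ := W.exists_isPath
    exact ⟨P, hP, fun e he => hW e (hsub he)⟩
  choose P hP hPT using hpath
  exact ⟨P, fun i => i, hP, fun i e he => hc i e (hPT i e he),
    fun i j hij e hi hj => Set.disjoint_left.1 (hdisj i j hij) (hPT i e hi) (hPT j e hj),
    Fin.val_injective⟩

/-- The simple graph obtained from the edges of colour `i` by identifying vertices along `f`. -/
def colorQuotient {W : Type*} (G : Multigraph V E) (f : V → W) (c : E → ℕ) (i : ℕ) :
    SimpleGraph W where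
  Adj a b := a ≠ b ∧ ∃ e, c e = i ∧ Sym2.map f (G.ends e) = s(a, b)
  symm := ⟨fun _ _ ⟨hab, e, he, h⟩ => ⟨hab.symm, e, he, h.trans Sym2.eq_swap⟩⟩
  loopless := ⟨fun _ h => h.1 rfl⟩

theorem Walk.reachable_colorQuotient {W : Type*} (f : V → W) (c : E → ℕ) (i : ℕ) {u v : V}
    (P : Walk G u v) (hP : ∀ e ∈ P.edges, c e = i) :
    (G.colorQuotient f c i).Reachable (f u) (f v) := by
  induction P with
  | nil => exact .refl _
  | @cons a b _ e he p ih =>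
    simp only [Walk.edges, List.mem_cons, forall_eq_or_imp] at hP
    refine SimpleGraph.Reachable.trans ?_ (ih hP.2)
    by_cases hab : f a = f b
    · rw [hab]
    · exact SimpleGraph.Adj.reachable ⟨hab, e, hP.1, by rw [he, Sym2.map_mk]⟩

theorem IsRMCColoring.tauGE [Fintype E] {k : ℕ} {c : E → ℕ} (h : G.IsRMCColoring k c) :
    G.TauGE k := by
  classical
  intro t f ht hf
  let r : Fin t := ⟨0, by omega⟩
  let H := G.colorQuotient f c
  let I := Finset.univ.image c
  have hcolor : ∀ i, {b | b ≠ r ∧ (H i).Reachable r b}.ncard ≤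
      {e | c e = i ∧ ¬ (Sym2.map f (G.ends e)).IsDiag}.ncard := by
    intro i
    refine (H i).ncard_reachable_le r (fun e => Sym2.map f (G.ends e)) _ ?_
    rintro a b ⟨hab, e, he, hends⟩
    exact ⟨e, ⟨he, by rwa [hends, Sym2.mk_isDiag_iff]⟩, hends⟩
  have hmany : ∀ b ∈ Finset.univ.erase r, k ≤ (I.filter fun i => (H i).Reachable r b).card := by
    intro b hb
    have hbr : b ≠ r := Finset.ne_of_mem_erase hb
    obtain ⟨u, hu⟩ := hf r
    obtain ⟨v, rfl⟩ := hf b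
    have huv : u ≠ v := by
      rintro rfl
      exact hbr hu
    obtain ⟨P, col, -, hmono, -, hinj⟩ := h u v huv
    have hsub : Finset.univ.image col ⊆ I.filter fun i => (H i).Reachable r (f v) := by
      intro i hi
      obtain ⟨j, -, rfl⟩ := Finset.mem_image.1 hi
      have hreach : (H (col j)).Reachable r (f v) := by
        rw [← hu]
        exact (P j).reachable_colorQuotient f c _ (hmono j)
      refine Finset.mem_filter.2 ⟨?_, hreach⟩
      obtain ⟨p⟩ := hreach
      obtain ⟨-, e, he, -⟩ := p.adj_snd (SimpleGraph.Walk.not_nil_of_ne hbr.symm)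
      exact Finset.mem_image.2 ⟨e, Finset.mem_univ _, he⟩
    simpa [Finset.card_image_of_injective _ hinj] using Finset.card_le_card hsub
  have hswap := Finset.sum_card_bipartiteAbove_eq_sum_card_bipartiteBelow
    (s := Finset.univ.erase r) (t := I) fun b i => (H i).Reachable r b
  calc k * (t - 1) = ∑ _b ∈ Finset.univ.erase r, k := by simp [mul_comm]
    _ ≤ ∑ b ∈ Finset.univ.erase r, (I.filter fun i => (H i).Reachable r b).card :=
        Finset.sum_le_sum hmany
    _ = ∑ i ∈ I, ((Finset.univ.erase r).filter fun b => (H i).Reachable r b).card := hswap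
    _ ≤ ∑ i ∈ I, ((Finset.univ.filter fun e => ¬ (Sym2.map f (G.ends e)).IsDiag).filter
          fun e => c e = i).card := by
        refine Finset.sum_le_sum fun i _ => ?_
        rw [← Set.ncard_coe_finset, ← Set.ncard_coe_finset]
        simpa [and_comm] using hcolor i
    _ = {e : E | ¬ (Sym2.map f (G.ends e)).IsDiag}.ncard := by
        rw [← Finset.card_eq_sum_card_fiberwise fun e _ => by simp [I],
          ← Set.ncard_coe_finset]
        simp

/-- The Nash-Williams–Tutte condition bounds the number of components of every edge set. -/
theorem TauGE.mul_card_connectedComponent_le [Fintype V] [Nonempty V] [Fintype E]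
    [DecidableEq E] {k : ℕ} (h : G.TauGE k) (A : Finset E) :
    k * Nat.card (G.toSimple A).ConnectedComponent ≤ Aᶜ.card + k := by
  set t := Nat.card (G.toSimple A).ConnectedComponent with ht
  have hpos : 0 < t := Nat.card_pos
  rcases (show t = 1 ∨ 2 ≤ t by omega) with h1 | h2
  · simp [h1]
  let φ := Finite.equivFin (G.toSimple A).ConnectedComponent
  have hle := h t (fun v => φ ((G.toSimple A).connectedComponentMk v)) h2
    (φ.surjective.comp Quot.mk_surjective)
  have hsub : {e : E | ¬ (Sym2.map (fun v => φ ((G.toSimple A).connectedComponentMk v))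
      (G.ends e)).IsDiag} ⊆ (Aᶜ : Finset E) := by
    intro e he
    rw [Finset.mem_coe, Finset.mem_compl]
    intro heA
    apply he
    obtain ⟨⟨u, v⟩, huv⟩ := Quot.exists_rep (G.ends e)
    have hends : G.ends e = s(u, v) := huv.symm
    rw [hends, Sym2.map_mk, Sym2.mk_isDiag_iff]
    have hadj : (G.toSimple A).Adj u v := ⟨e, heA, hends⟩
    exact congrArg φ (SimpleGraph.ConnectedComponent.sound hadj.reachable)
  have hcard := Set.ncard_le_ncard hsub (Finset.finite_toSet _)
  rw [Set.ncard_coe_finset] at hcard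
  obtain ⟨s, hs⟩ : ∃ s, t = s + 1 := ⟨t - 1, by omega⟩
  have hle' := hle.trans hcard
  rw [hs, Nat.add_sub_cancel] at hle'
  rw [hs, mul_add, mul_one]
  omega

/-- A set of edges connecting all vertices contains a spanning tree. -/
theorem exists_isSpanningTree_subset [Fintype V] {A : Set E}
    (h : (G.toSimple A).Connected) : ∃ T ⊆ A, G.IsSpanningTree T := by
  classical
  obtain ⟨H, hle, hH⟩ := h.exists_isTree_le
  have hedge : ∀ x : H.edgeSet, ∃ e ∈ A, G.ends e = x := by
    rintro ⟨x, hx⟩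
    induction x with
    | _ u v => exact hle hx
  choose g hgA hg using hedge
  have hinj : Function.Injective g := fun x y hxy => Subtype.ext (by rw [← hg x, hxy, hg y])
  refine ⟨Set.range g, ?_, ?_, ?_⟩
  · rintro _ ⟨x, rfl⟩
    exact hgA x
  · intro u v
    refine exists_walk_of_reachable ((hH.connected u v).mono ?_)
    intro a b hab
    exact ⟨g ⟨s(a, b), hab⟩, ⟨_, rfl⟩, hg _⟩
  · have hcard := hH.card_edgeFinset
    rw [← Set.image_univ, Set.ncard_image_of_injective _ hinj, Set.ncard_univ,
      Nat.card_eq_fintype_card, ← SimpleGraph.edgeFinset_card]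
    omega

theorem TauGE.hasEdgeDisjointSpanningTrees [Fintype V] [Fintype E] {k : ℕ} (h : G.TauGE k) :
    G.HasEdgeDisjointSpanningTrees k := by
  classical
  rcases isEmpty_or_nonempty V with hV | hV
  · exact ⟨fun _ => ∅, fun _ => ⟨fun u => isEmptyElim u, by simp⟩, fun _ _ _ => by simp⟩
  obtain ⟨F, hdisj, hsum⟩ := exists_pairwise_disjoint_sum_le
    (fun (_ : Fin k) (A : Finset E) => Nat.card (G.toSimple A).ConnectedComponent)
    (fun _ A B hAB => SimpleGraph.card_connectedComponent_anti
      (toSimple_mono (Finset.coe_subset.2 hAB)))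
    (fun _ X Y => by
      rw [Finset.coe_union, toSimple_union]
      exact SimpleGraph.card_connectedComponent_add_le
        (toSimple_mono (Finset.coe_subset.2 Finset.inter_subset_left))
        (toSimple_mono (Finset.coe_subset.2 Finset.inter_subset_right)))
    k (fun A => by simpa using h.mul_card_connectedComponent_le A)
  have hpos : ∀ i, 1 ≤ Nat.card (G.toSimple (F i)).ConnectedComponent := fun i => Nat.card_pos
  have hone : ∀ i, 1 = Nat.card (G.toSimple (F i)).ConnectedComponent := by
    have heq := (Finset.sum_eq_sum_iff_of_le fun i (_ : i ∈ Finset.univ) => hpos i).1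
      (le_antisymm (Finset.sum_le_sum fun i _ => hpos i) (by simpa using hsum))
    exact fun i => heq i (Finset.mem_univ i)
  have htree : ∀ i, ∃ T ⊆ (F i : Set E), G.IsSpanningTree T := by
    intro i
    apply exists_isSpanningTree_subset
    have := (Nat.card_eq_one_iff_unique.1 (hone i).symm).1
    exact ⟨fun u v => SimpleGraph.ConnectedComponent.exact (Subsingleton.elim _ _)⟩
  choose T hTF hT using htree
  exact ⟨T, hT, fun i j hij =>
    (Finset.disjoint_coe.2 (hdisj i j hij)).mono (hTF i) (hTF j)⟩

end Multigraph

/-- Theorem 3.1: a loopless multigraph has an RMC_k-coloring iff `τ(G) ≥ k`,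
equivalently, iff it has `k` pairwise edge-disjoint spanning trees. -/
theorem isRMCColoring_iff_tauGE {V E : Type*} [Fintype V] [Fintype E]
    (G : Multigraph V E) (k : ℕ) (hk : 1 ≤ k) :
    ((∃ c : E → ℕ, G.IsRMCColoring k c) ↔ G.TauGE k) ∧
    (G.TauGE k ↔ G.HasEdgeDisjointSpanningTrees k) := by
  have hTau : (∃ c : E → ℕ, G.IsRMCColoring k c) → G.TauGE k := fun ⟨_, hc⟩ => hc.tauGE
  exact ⟨⟨hTau, fun h => h.hasEdgeDisjointSpanningTrees.exists_isRMCColoring⟩,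
    fun h => h.hasEdgeDisjointSpanningTrees, fun h => hTau h.exists_isRMCColoring⟩
end

section
/- Let G be a loopless multigraph on n vertices with m edges and k a positive integer. If G has an RMC_k-coloring, then m ≥ k(n − 1). -/
namespace Multigraph

/-- The least length of a walk from `u` to `r` all of whose edges have color `i`,
or `0` if there is no such walk. -/
noncomputable def colorDist {V E : Type*} (G : Multigraph V E) (c : E → ℕ) (r : V) (i : ℕ)
    (u : V) : ℕ :=
  sInf {d | ∃ W : Walk G u r, (∀ e ∈ W.edges, c e = i) ∧ W.edges.length = d}

/-- A vertex `u ≠ r` joined to `r` in color `i` has an edge of color `i` leading to a vertex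
strictly closer to `r` in that color. -/
theorem exists_edge_colorDist_lt {V E : Type*} (G : Multigraph V E) (c : E → ℕ) {r u : V}
    {i : ℕ} (hur : u ≠ r) (W : Walk G u r) (hW : ∀ e ∈ W.edges, c e = i) :
    ∃ e w, c e = i ∧ G.ends e = s(u, w) ∧ G.colorDist c r i w < G.colorDist c r i u := by
  obtain ⟨W', hcol, hlen⟩ : G.colorDist c r i u ∈
      {d | ∃ W : Walk G u r, (∀ e ∈ W.edges, c e = i) ∧ W.edges.length = d} :=
    Nat.sInf_mem ⟨_, W, hW, rfl⟩
  cases W' with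
  | nil => exact absurd rfl hur
  | @cons _ w _ e he p =>
    simp only [Walk.edges, List.mem_cons, forall_eq_or_imp, List.length_cons] at hcol hlen
    refine ⟨e, w, hcol.1, he, ?_⟩
    have hle : G.colorDist c r i w ≤ p.edges.length := Nat.sInf_le ⟨p, hcol.2, rfl⟩
    omega

end Multigraph

/-- Claim 3.2: if a loopless multigraph with `n` vertices and `m` edges has an
RMC_k-coloring, then `m ≥ k(n-1)`. -/
theorem card_edges_ge_of_isRMCColoring {V E : Type*} [Fintype V] [Fintype E]
    (G : Multigraph V E) (k : ℕ) (hk : 1 ≤ k)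
    (h : ∃ c : E → ℕ, G.IsRMCColoring k c) :
    k * (Fintype.card V - 1) ≤ Fintype.card E := by
  classical
  obtain ⟨c, hc⟩ := h
  rcases isEmpty_or_nonempty V with hV | ⟨⟨r⟩⟩
  · simp
  choose P col _ hcol _ hinj using fun u : {u : V // u ≠ r} => hc u r u.2
  choose f w hf hends hlt using fun x : Fin k × {u : V // u ≠ r} =>
    G.exists_edge_colorDist_lt c x.2.2 (P x.2 x.1) (hcol x.2 x.1)
  have hf_inj : Function.Injective f := by
    rintro ⟨j, u⟩ ⟨j', u'⟩ hff
    have hcc : col u j = col u' j' := by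
      rw [← hf (j, u), ← hf (j', u'), hff]
    have huu : u = u' := by
      have hE := hends (j, u)
      rw [hff, hends (j', u'), Sym2.eq_iff] at hE
      rcases hE with ⟨h₁, -⟩ | ⟨h₁, h₂⟩
      · exact Subtype.ext h₁.symm
      · have hl := hlt (j, u)
        have hl' := hlt (j', u')
        simp only at h₁ h₂ hl hl'
        rw [← h₁, hcc] at hl
        rw [h₂] at hl'
        omega
    subst huu
    rw [hinj u hcc]
  simpa [Fintype.card_subtype_compl] using Fintype.card_le_of_injective f hf_inj
end

section
/- Let G be a simple graph on n vertices with m edges, and let k be a positive integer with τ(G) ≥ k. Then rmc_k(G) ≥ m − k(n − 2). -/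
open SimpleGraph

/-- The coloring giving every edge of the `i`-th graph of the family `T` the color `i`, and every
other edge `e` the color `k + f e`. -/
noncomputable def SimpleGraph.familyColoring {V : Type*} {k : ℕ} (T : Fin k → SimpleGraph V)
    (f : Sym2 V → ℕ) (e : Sym2 V) : ℕ :=
  open Classical in if h : ∃ i, e ∈ (T i).edgeSet then (h.choose : ℕ) else k + f e

theorem SimpleGraph.familyColoring_of_mem {V : Type*} {k : ℕ} {T : Fin k → SimpleGraph V}
    (hdisj : ∀ i j, i ≠ j → Disjoint (T i).edgeSet (T j).edgeSet) (f : Sym2 V → ℕ)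
    {i : Fin k} {e : Sym2 V} (he : e ∈ (T i).edgeSet) : familyColoring T f e = i := by
  have h : ∃ i, e ∈ (T i).edgeSet := ⟨i, he⟩
  rw [familyColoring, dif_pos h]
  by_contra hne
  exact Set.disjoint_left.1 (hdisj h.choose i fun hi => hne (congrArg Fin.val hi)) h.choose_spec he

theorem SimpleGraph.familyColoring_of_notMem {V : Type*} {k : ℕ} {T : Fin k → SimpleGraph V}
    (f : Sym2 V → ℕ) {e : Sym2 V} (he : e ∉ ⋃ i, (T i).edgeSet) :
    familyColoring T f e = k + f e := by
  rw [familyColoring, dif_neg (by simpa using he)]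

theorem SimpleGraph.isRMCColoring_familyColoring {V : Type*} {G : SimpleGraph V} {k : ℕ}
    {T : Fin k → SimpleGraph V} (hle : ∀ i, T i ≤ G) (hconn : ∀ i, (T i).Connected)
    (hdisj : ∀ i j, i ≠ j → Disjoint (T i).edgeSet (T j).edgeSet) (f : Sym2 V → ℕ) :
    G.IsRMCColoring k (familyColoring T f) := by
  intro u v _
  choose P hP using fun i => (hconn i).exists_isPath u v
  have hmem : ∀ i, ∀ e ∈ ((P i).mapLe (hle i)).edges, e ∈ (T i).edgeSet := fun i e he =>
    (P i).edges_subset_edgeSet (by rwa [Walk.edges_mapLe_eq_edges] at he)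
  refine ⟨fun i => (P i).mapLe (hle i), fun i => i, fun i => (hP i).mapLe (hle i),
    fun i e he => familyColoring_of_mem hdisj f (hmem i e he), fun i j hij e hi hj => ?_,
    Fin.val_injective⟩
  exact Set.disjoint_left.1 (hdisj i j hij) (hmem i e hi) (hmem j e hj)

theorem SimpleGraph.ncard_edgeSet_add_le_colorsUsed_familyColoring {V : Type*} [Finite V]
    {G : SimpleGraph V} {k : ℕ} {T : Fin k → SimpleGraph V} (hle : ∀ i, T i ≤ G)
    (hne : ∀ i, (T i).edgeSet.Nonempty)
    (hdisj : ∀ i j, i ≠ j → Disjoint (T i).edgeSet (T j).edgeSet)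
    {f : Sym2 V → ℕ} (hf : Function.Injective f) :
    G.edgeSet.ncard + k ≤
      G.colorsUsed (familyColoring T f) + (⋃ i, (T i).edgeSet).ncard := by
  set U := ⋃ i, (T i).edgeSet
  set R := (fun e => k + f e) '' (G.edgeSet \ U)
  have hsub : Set.range (Fin.val : Fin k → ℕ) ∪ R ⊆ familyColoring T f '' G.edgeSet := by
    rintro _ (⟨i, rfl⟩ | ⟨e, he, rfl⟩)
    · obtain ⟨e, he⟩ := hne i
      exact ⟨e, edgeSet_mono (hle i) he, familyColoring_of_mem hdisj f he⟩
    · exact ⟨e, he.1, familyColoring_of_notMem f he.2⟩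
  have hRdisj : Disjoint (Set.range (Fin.val : Fin k → ℕ)) R := by
    rw [Set.disjoint_left]
    rintro _ ⟨i, rfl⟩ ⟨e, -, he⟩
    have := i.isLt
    simp only at he
    omega
  have hR : R.ncard = (G.edgeSet \ U).ncard :=
    Set.ncard_image_of_injective _ fun a b hab => hf (Nat.add_left_cancel hab)
  have hk : (Set.range (Fin.val : Fin k → ℕ)).ncard = k := by
    rw [← Set.image_univ, Set.ncard_image_of_injective _ Fin.val_injective, Set.ncard_univ,
      Nat.card_fin]
  have hcard := Set.ncard_le_ncard hsub (Set.toFinite _)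
  rw [Set.ncard_union_eq hRdisj (Set.toFinite _) (Set.toFinite _), hk, hR] at hcard
  have hE := Set.ncard_le_ncard_sdiff_add_ncard G.edgeSet U (Set.toFinite _)
  unfold colorsUsed
  omega

theorem SimpleGraph.IsRMCColoring.colorsUsed_le_rmc {V : Type*} [Finite V] {G : SimpleGraph V}
    {k : ℕ} {c : Sym2 V → ℕ} (hc : G.IsRMCColoring k c) : G.colorsUsed c ≤ G.rmc k := by
  refine le_csSup ⟨G.edgeSet.ncard, ?_⟩ ⟨c, hc, rfl⟩
  rintro _ ⟨c', -, rfl⟩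
  exact Set.ncard_image_le (Set.toFinite _)

theorem SimpleGraph.IsTree.ncard_edgeSet_add_one {V : Type*} [Finite V] {T : SimpleGraph V}
    (hT : T.IsTree) : T.edgeSet.ncard + 1 = Nat.card V := by
  rw [← Nat.card_coe_set_eq]
  exact (isTree_iff_connected_and_card.1 hT).2

/-- If `τ(G) ≥ k` then `rmc_k(G) ≥ m - k(n-2)`. -/
theorem rmc_ge_of_tauGE {V : Type*} [Fintype V] (G : SimpleGraph V) (k : ℕ)
    (hk : 1 ≤ k) (htau : G.TauGE k) :
    G.edgeSet.ncard - k * (Fintype.card V - 2) ≤ G.rmc k := by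
  obtain ⟨T, hle, htree, hdisj⟩ := htau
  have hT : ∀ i, (T i).edgeSet.ncard + 1 = Fintype.card V := fun i => by
    rw [(htree i).ncard_edgeSet_add_one, Nat.card_eq_fintype_card]
  rcases subsingleton_or_nontrivial V with hV | hV
  · have hG : G.edgeSet = ∅ := by rw [Subsingleton.elim G ⊥, edgeSet_bot]
    simp [hG]
  have hn : 2 ≤ Fintype.card V := Fintype.one_lt_card
  have hne : ∀ i, (T i).edgeSet.Nonempty := fun i =>
    Set.nonempty_of_ncard_ne_zero (by have := hT i; omega)
  obtain ⟨f, hf⟩ := Countable.exists_injective_nat (Sym2 V)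
  have hcol := ncard_edgeSet_add_le_colorsUsed_familyColoring hle hne hdisj hf
  have hrmc := IsRMCColoring.colorsUsed_le_rmc
    (isRMCColoring_familyColoring hle (fun i => (htree i).connected) hdisj f)
  have hU : (⋃ i, (T i).edgeSet).ncard ≤ k * (Fintype.card V - 2) + k := by
    calc (⋃ i, (T i).edgeSet).ncard ≤ ∑ i, (T i).edgeSet.ncard :=
          Set.ncard_iUnion_le_of_fintype _
      _ = ∑ _i : Fin k, (Fintype.card V - 2 + 1) :=
          Finset.sum_congr rfl fun i _ => by have := hT i; omega
      _ = k * (Fintype.card V - 2) + k := by simp [Nat.mul_add]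
  omega
end

section
/- Let G be a simple graph on n vertices with m edges, and let k be a positive integer with τ(G) ≥ k. Then rmc_k(G) ≤ m − k(n − 2) + n_G, where n_G is the minimum, over all pairs of distinct vertices u, v of G, of the number of common neighbors of u and v. -/
open SimpleGraph

/-- `n_G`: the minimum number of common neighbours over all pairs of distinct vertices. -/
noncomputable def SimpleGraph.minCommonNbrs {V : Type*} (G : SimpleGraph V) : ℕ :=
  sInf {t | ∃ u v : V, u ≠ v ∧ {w : V | G.Adj u w ∧ G.Adj v w}.ncard = t}

namespace SimpleGraph

variable {V : Type*}

/-- The spanning subgraph of `G` formed by the edges of color `i`. -/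
def colorGraph (G : SimpleGraph V) (c : Sym2 V → ℕ) (i : ℕ) : SimpleGraph V where
  Adj a b := G.Adj a b ∧ c s(a, b) = i
  symm := ⟨fun a b h => ⟨h.1.symm, by rw [Sym2.eq_swap]; exact h.2⟩⟩
  loopless := ⟨fun a h => h.1.ne rfl⟩

lemma Walk.IsMonochromatic.reachable_colorGraph {G : SimpleGraph V} {c : Sym2 V → ℕ} {u v : V}
    {W : G.Walk u v} {i : ℕ} (h : W.IsMonochromatic c i) : (G.colorGraph c i).Reachable u v := by
  induction W with
  | nil => exact .refl _
  | cons hadj p ih =>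
    have hfirst : (G.colorGraph c i).Adj _ _ := ⟨hadj, h _ (by simp)⟩
    exact hfirst.reachable.trans (ih fun e he => h e (by simp [he]))

lemma Reachable.exists_adj {H : SimpleGraph V} {u w : V} (h : H.Reachable u w) (hne : w ≠ u) :
    ∃ p, H.Adj u p := by
  obtain ⟨W⟩ := h
  cases W with
  | nil => exact absurd rfl hne
  | cons hadj _ => exact ⟨_, hadj⟩

lemma Reachable.exists_adj_dist_lt {H : SimpleGraph V} {u w : V} (h : H.Reachable u w)
    (hne : w ≠ u) : ∃ p, H.Adj w p ∧ H.dist u p < H.dist u w := by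
  obtain ⟨W, hW⟩ := h.symm.exists_walk_length_eq_dist
  cases W with
  | nil => exact absurd rfl hne
  | @cons _ p _ hadj q =>
    refine ⟨p, hadj, ?_⟩
    rw [Walk.length_cons] at hW
    have := dist_le q
    rw [dist_comm (u := u) (v := p), dist_comm (u := u) (v := w)]
    omega

/-- A set of vertices reachable from a root outside the set has at most as many elements as the
graph has edges. -/
lemma card_le_ncard_edgeSet_of_reachable [Finite V] {H : SimpleGraph V} {u : V} (S : Finset V)
    (hS : ∀ w ∈ S, w ≠ u ∧ H.Reachable u w) : S.card ≤ H.edgeSet.ncard := by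
  have hparent : ∀ w ∈ S, ∃ p, H.Adj w p ∧ H.dist u p < H.dist u w :=
    fun w hw => (hS w hw).2.exists_adj_dist_lt (hS w hw).1
  choose! p hadj hlt using hparent
  rw [← Set.ncard_coe_finset]
  refine Set.ncard_le_ncard_of_injOn (fun w => s(w, p w)) (fun w hw => hadj w hw) ?_
    (Set.toFinite _)
  intro w hw x hx heq
  rcases Sym2.eq_iff.1 heq with h | ⟨h₁, h₂⟩
  · exact h.1
  · have h₃ := hlt w hw
    have h₄ := hlt x hx
    rw [h₂] at h₃
    rw [← h₁] at h₄
    exact absurd h₃ h₄.asymm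

lemma card_add_one_le_of_reachable [Finite V] {H : SimpleGraph V} {u v : V} (huv : u ≠ v)
    (hr : H.Reachable u v) (S : Finset V)
    (hS : ∀ w ∈ S, w ≠ u ∧ w ≠ v ∧ (H.Reachable u w ∨ H.Reachable v w)) :
    S.card + 1 ≤ H.edgeSet.ncard := by
  classical
  rw [← Finset.card_insert_of_notMem fun h => (hS v h).2.1 rfl]
  refine card_le_ncard_edgeSet_of_reachable (u := u) _ fun w hw => ?_
  rcases Finset.mem_insert.1 hw with rfl | hw
  · exact ⟨huv.symm, hr⟩
  · exact ⟨(hS w hw).1, (hS w hw).2.2.elim id hr.trans⟩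

lemma card_le_of_reachable_or [Finite V] {H : SimpleGraph V} {u v : V} (huv : u ≠ v)
    (S : Finset V) (hS : ∀ w ∈ S, w ≠ u ∧ w ≠ v ∧ (H.Reachable u w ∨ H.Reachable v w)) :
    S.card ≤ H.edgeSet.ncard := by
  have hle : H ≤ H ⊔ edge u v := le_sup_left
  have hadj : (H ⊔ edge u v).Adj u v := Or.inr (by simp [edge_adj, huv])
  have hcard := card_add_one_le_of_reachable huv hadj.reachable S fun w hw =>
    ⟨(hS w hw).1, (hS w hw).2.1, (hS w hw).2.2.imp (·.mono hle) (·.mono hle)⟩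
  have hsub : (H ⊔ edge u v).edgeSet ⊆ insert s(u, v) H.edgeSet := by
    rw [edgeSet_sup, edgeSet_edge_of_ne huv, Set.union_singleton]
  have := Set.ncard_le_ncard hsub (Set.toFinite _)
  have := Set.ncard_insert_le s(u, v) H.edgeSet
  omega

open Classical in
/-- Every RMC-coloring loses at least `k` colors for each vertex other than `u` and `v`, except for
one color per common neighbor of `u` and `v`. -/
lemma IsRMCColoring.colorsUsed_add_le [Fintype V] {G : SimpleGraph V} {k : ℕ} {c : Sym2 V → ℕ}
    (hc : G.IsRMCColoring k c) {u v : V} (huv : u ≠ v) :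
    G.colorsUsed c + k * (Fintype.card V - 2) ≤
      G.edgeSet.ncard + {w : V | G.Adj u w ∧ G.Adj v w}.ncard := by
  set H := G.colorGraph c with hH
  set K : Finset ℕ := G.edgeFinset.image c with hK
  set X : Finset V := {w | w ≠ u ∧ w ≠ v} with hX
  let R : V → ℕ → Prop := fun w i => (H i).Reachable u w ∨ (H i).Reachable v w
  let B : Finset ℕ := K.filter fun i =>
    ¬ (H i).Reachable u v ∧ ∃ w, (H i).Adj u w ∨ (H i).Adj v w
  have memK : ∀ {i a b}, (H i).Adj a b → i ∈ K := fun {i a b} h =>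
    Finset.mem_image.2 ⟨s(a, b), by simpa using h.1, h.2⟩
  have hXcard : X.card = Fintype.card V - 2 := by
    have : X = Finset.univ \ {u, v} := by ext; simp [hX]
    rw [this, Finset.card_sdiff_of_subset (Finset.subset_univ _), Finset.card_pair huv,
      Finset.card_univ]
  have hcolors : G.colorsUsed c = K.card := by
    rw [colorsUsed, ← Set.ncard_coe_finset]
    simp [hK]
  have hedges : G.edgeSet.ncard = ∑ i ∈ K, (H i).edgeSet.ncard := by
    rw [← coe_edgeFinset, Set.ncard_coe_finset, Finset.card_eq_sum_card_image c]
    refine Finset.sum_congr rfl fun i _ => ?_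
    rw [← Set.ncard_coe_finset]
    congr 1
    ext e
    induction e with
    | _ a b => simp [hH, colorGraph]
  have hclass : ∀ i ∈ K, (X.filter (R · i)).card + 1 ≤
      (H i).edgeSet.ncard + if i ∈ B then 1 else 0 := by
    intro i hi
    have hS : ∀ w ∈ X.filter (R · i),
        w ≠ u ∧ w ≠ v ∧ ((H i).Reachable u w ∨ (H i).Reachable v w) := by
      intro w hw
      simpa [hX, R, and_assoc] using hw
    by_cases hr : (H i).Reachable u v
    · exact (card_add_one_le_of_reachable huv hr _ hS).trans (Nat.le_add_right _ _)
    by_cases hB : i ∈ B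
    · rw [if_pos hB]
      exact Nat.add_le_add_right (card_le_of_reachable_or huv _ hS) 1
    · have hempty : X.filter (R · i) = ∅ := by
        refine Finset.eq_empty_of_forall_notMem fun w hw => hB ?_
        obtain ⟨hwu, hwv, h | h⟩ := hS w hw
        · obtain ⟨p, hp⟩ := h.exists_adj hwu
          exact Finset.mem_filter.2 ⟨hi, hr, p, Or.inl hp⟩
        · obtain ⟨p, hp⟩ := h.exists_adj hwv
          exact Finset.mem_filter.2 ⟨hi, hr, p, Or.inr hp⟩
      obtain ⟨e, he, hei⟩ := Finset.mem_image.1 hi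
      have hpos : 0 < (H i).edgeSet.ncard := by
        rw [Set.ncard_pos (Set.toFinite _)]
        induction e with
        | _ a b => exact ⟨s(a, b), by simpa using he, hei⟩
      rw [hempty, Finset.card_empty]
      omega
  have hBK : ∑ i ∈ K, (if i ∈ B then 1 else 0) = B.card := by
    rw [← Finset.card_filter, Finset.filter_mem_eq_inter,
      Finset.inter_eq_right.2 (Finset.filter_subset _ _)]
  have hsum := Finset.sum_le_sum hclass
  rw [Finset.sum_add_distrib, Finset.sum_add_distrib, ← hedges, hBK, Finset.sum_const,
    smul_eq_mul, mul_one, ← hcolors] at hsum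
  have hdouble : ∑ i ∈ K, (X.filter (R · i)).card = ∑ w ∈ X, (K.filter (R w)).card :=
    (Finset.sum_card_bipartiteAbove_eq_sum_card_bipartiteBelow R).symm
  have hnbr : ∀ i ∈ B, ∃ w ∈ X, (H i).Adj u w ∨ (H i).Adj v w := by
    intro i hi
    obtain ⟨-, hr, w, hw⟩ := Finset.mem_filter.1 hi
    refine ⟨w, ?_, hw⟩
    simp only [hX, Finset.mem_filter, Finset.mem_univ, true_and]
    constructor
    · rintro rfl
      exact hw.elim (fun h => h.ne rfl) fun h => hr h.reachable.symm
    · rintro rfl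
      exact hw.elim (fun h => hr h.reachable) fun h => h.ne rfl
  have : Nonempty V := ⟨u⟩
  choose! g hgX hg using hnbr
  have hpaths : ∀ a w, a ≠ w → ∃ C : Finset ℕ, C.card = k ∧ C ⊆ K ∧
      ∀ i ∈ C, (H i).Reachable a w := by
    intro a w haw
    obtain ⟨P, col, -, hmono, -, hinj⟩ := hc a w haw
    have hreach : ∀ j, (H (col j)).Reachable a w := fun j => (hmono j).reachable_colorGraph
    refine ⟨Finset.univ.image col, ?_, ?_, ?_⟩
    · simp [Finset.card_image_of_injective _ hinj]
    · intro i hi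
      obtain ⟨j, -, rfl⟩ := Finset.mem_image.1 hi
      obtain ⟨p, hp⟩ := (hreach j).exists_adj haw.symm
      exact memK hp
    · intro i hi
      obtain ⟨j, -, rfl⟩ := Finset.mem_image.1 hi
      exact hreach j
  have hvertex : ∀ w ∈ X, k + (B.filter (g · = w)).card ≤
      (K.filter (R w)).card + if G.Adj u w ∧ G.Adj v w then 1 else 0 := by
    intro w hw
    obtain ⟨hwu, hwv⟩ : w ≠ u ∧ w ≠ v := by simpa [hX] using hw
    obtain ⟨Cu, hCu, hCuK, hCur⟩ := hpaths u w hwu.symm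
    obtain ⟨Cv, hCv, hCvK, hCvr⟩ := hpaths v w hwv.symm
    have hfib : ∀ i ∈ B.filter (g · = w),
        i ∈ K ∧ ¬ (H i).Reachable u v ∧ ((H i).Adj u w ∨ (H i).Adj v w) := by
      intro i hi
      obtain ⟨hiB, rfl⟩ := Finset.mem_filter.1 hi
      obtain ⟨hiK, hr, -⟩ := Finset.mem_filter.1 hiB
      exact ⟨hiK, hr, hg i hiB⟩
    have hCuR : Cu ⊆ K.filter (R w) := fun i hi =>
      Finset.mem_filter.2 ⟨hCuK hi, Or.inl (hCur i hi)⟩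
    have hCvR : Cv ⊆ K.filter (R w) := fun i hi =>
      Finset.mem_filter.2 ⟨hCvK hi, Or.inr (hCvr i hi)⟩
    rcases (B.filter (g · = w)).eq_empty_or_nonempty with hF | ⟨i, hi⟩
    · rw [hF, Finset.card_empty, ← hCu]
      exact (Finset.card_le_card hCuR).trans (Nat.le_add_right _ _)
    have hlarge : k + 1 ≤ (K.filter (R w)).card := by
      obtain ⟨hiK, hr, h | h⟩ := hfib i hi
      · have hnot : i ∉ Cv := fun hiC => hr (h.reachable.trans (hCvr i hiC).symm)
        rw [← hCv, ← Finset.card_insert_of_notMem hnot]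
        exact Finset.card_le_card (Finset.insert_subset
          (Finset.mem_filter.2 ⟨hiK, Or.inl h.reachable⟩) hCvR)
      · have hnot : i ∉ Cu := fun hiC => hr ((hCur i hiC).trans h.reachable.symm)
        rw [← hCu, ← Finset.card_insert_of_notMem hnot]
        exact Finset.card_le_card (Finset.insert_subset
          (Finset.mem_filter.2 ⟨hiK, Or.inr h.reachable⟩) hCuR)
    have htwo : (B.filter (g · = w)).card ≤ 2 := by
      refine (Finset.card_le_card (t := {c s(u, w), c s(v, w)}) fun j hj => ?_).trans
        Finset.card_le_two
      rcases (hfib j hj).2.2 with h | h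
      · simp [← h.2]
      · simp [← h.2]
    by_cases hcommon : G.Adj u w ∧ G.Adj v w
    · rw [if_pos hcommon]
      omega
    · have hone : (B.filter (g · = w)).card ≤ 1 := by
        refine Finset.card_le_one.2 fun a ha b hb => ?_
        rcases (hfib a ha).2.2 with h | h <;> rcases (hfib b hb).2.2 with h' | h'
        · exact h.2.symm.trans h'.2
        · exact absurd ⟨h.1, h'.1⟩ hcommon
        · exact absurd ⟨h'.1, h.1⟩ hcommon
        · exact h.2.symm.trans h'.2
      omega
  have hsum' := Finset.sum_le_sum hvertex
  rw [Finset.sum_add_distrib, Finset.sum_add_distrib, Finset.sum_const, smul_eq_mul, hXcard,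
    ← Finset.card_eq_sum_card_fiberwise hgX, ← Finset.card_filter] at hsum'
  have hcommon : (X.filter fun w => G.Adj u w ∧ G.Adj v w).card ≤
      {w : V | G.Adj u w ∧ G.Adj v w}.ncard := by
    rw [← Set.ncard_coe_finset]
    exact Set.ncard_le_ncard (fun w hw => (Finset.mem_filter.1 hw).2) (Set.toFinite _)
  rw [mul_comm k]
  omega

end SimpleGraph

/-- If `τ(G) ≥ k` then `rmc_k(G) ≤ m - k(n-2) + n_G`. -/
theorem rmc_le_add_minCommonNbrs {V : Type*} [Fintype V] (G : SimpleGraph V) (k : ℕ)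
    (hk : 1 ≤ k) (htau : G.TauGE k) :
    G.rmc k ≤ G.edgeSet.ncard - k * (Fintype.card V - 2) + G.minCommonNbrs := by
  refine csSup_le' ?_
  rintro t ⟨c, hc, rfl⟩
  cases subsingleton_or_nontrivial V with
  | inl h =>
    have hbot : G = ⊥ := Subsingleton.elim _ _
    simp [colorsUsed, hbot]
  | inr h =>
    obtain ⟨a, b, hab⟩ := exists_pair_ne V
    obtain ⟨u, v, huv, hmin⟩ :=
      Nat.sInf_mem (s := {t | ∃ u v : V, u ≠ v ∧ {w : V | G.Adj u w ∧ G.Adj v w}.ncard = t})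
        ⟨_, a, b, hab, rfl⟩
    have hbound := hc.colorsUsed_add_le huv
    rw [hmin] at hbound
    change _ ≤ _ + G.minCommonNbrs at hbound
    omega
end

section
/- Let G be a simple graph on n vertices with m edges, and let k ≥ 2 be an integer with τ(G) ≥ k. If G has a cut vertex (a vertex whose removal disconnects G), then rmc_k(G) = m − k(n − 2). -/
open SimpleGraph

/-- A graph has at least as many edges as there are vertices, other than `v`, reachable
from `v`. -/
theorem SimpleGraph.ncard_reachable_le_ncard_edgeSet {V : Type*} [Finite V]
    (H : SimpleGraph V) (v : V) :
    {u | u ≠ v ∧ H.Reachable v u}.ncard ≤ H.edgeSet.ncard := by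
  have hconn : H.connectedComponentMk v |>.toSimpleGraph.Connected :=
    ConnectedComponent.connected_toSimpleGraph _
  have h1 := hconn.card_vert_le_card_edgeSet_add_one
  have h2 : {u | u ≠ v ∧ H.Reachable v u}.ncard + 1
      = (H.connectedComponentMk v).supp.ncard := by
    rw [← Set.ncard_insert_of_notMem (a := v) (by simp)]
    congr 1
    ext u
    by_cases huv : u = v
    · simp [huv]
    · simp [huv, ConnectedComponent.eq, reachable_comm]
  have h3 : Nat.card (H.connectedComponentMk v).toSimpleGraph.edgeSet ≤ H.edgeSet.ncard := by
    rw [← Nat.card_coe_set_eq]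
    exact Nat.card_le_card_of_injective _
      ((Embedding.induce (G := H) (H.connectedComponentMk v).supp).mapEdgeSet.injective)
  change Nat.card (H.connectedComponentMk v).supp ≤ _ at h1
  rw [Nat.card_coe_set_eq] at h1
  omega

theorem SimpleGraph.edgeSet_colorClass {V : Type*} (G : SimpleGraph V) (c : Sym2 V → ℕ) (i : ℕ) :
    (G.colorClass c i).edgeSet = {e | e ∈ G.edgeSet ∧ c e = i} := by
  rw [colorClass, edgeSet_fromEdgeSet, sdiff_eq_left, Set.disjoint_left]
  exact fun e he hd => G.not_isDiag_of_mem_edgeSet he.1 hd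

theorem SimpleGraph.Walk.IsMonochromatic.reachable {V : Type*} {G : SimpleGraph V}
    {c : Sym2 V → ℕ} {u v : V} {W : G.Walk u v} {i : ℕ} (h : W.IsMonochromatic c i) {w : V}
    (hw : w ∈ W.support) :
    (G.colorClass c i).Reachable w u ∧ (G.colorClass c i).Reachable w v := by
  classical
  have key : ∀ e ∈ W.edges, e ∈ (G.colorClass c i).edgeSet := fun e he => by
    rw [edgeSet_colorClass]
    exact ⟨W.edges_subset_edgeSet he, h e he⟩
  exact ⟨⟨((W.takeUntil w hw).transfer _
      fun e he => key e (W.edges_takeUntil_subset_edges hw he)).reverse⟩,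
    ⟨(W.dropUntil w hw).transfer _
      fun e he => key e (W.edges_dropUntil_subset_edges hw he)⟩⟩

/-- If all `u`–`w` walks pass through `v`, then an RMC coloring has at least `k` colors in which
`v` is connected to both `u` and `w`. -/
theorem SimpleGraph.IsRMCColoring.le_ncard_separating {V : Type*} [Finite V] {G : SimpleGraph V}
    {k : ℕ} {c : Sym2 V → ℕ} (hc : G.IsRMCColoring k c) {u v w : V} (huw : u ≠ w)
    (hsep : ∀ W : G.Walk u w, v ∈ W.support) :
    k ≤ {i | i ∈ c '' G.edgeSet ∧ (G.colorClass c i).Reachable v u ∧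
      (G.colorClass c i).Reachable v w}.ncard := by
  obtain ⟨P, col, -, hmono, -, hinj⟩ := hc u w huw
  have hfin : {i | i ∈ c '' G.edgeSet ∧ (G.colorClass c i).Reachable v u ∧
      (G.colorClass c i).Reachable v w}.Finite :=
    ((Set.toFinite G.edgeSet).image c).subset fun i hi => hi.1
  have hrange : (Set.range col).ncard = k := by
    rw [← Set.image_univ, Set.ncard_image_of_injective _ hinj, Set.ncard_univ, Nat.card_fin]
  rw [← hrange]
  refine Set.ncard_le_ncard ?_ hfin
  rintro _ ⟨i, rfl⟩
  refine ⟨?_, (hmono i).reachable (hsep (P i))⟩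
  obtain ⟨e, he⟩ := List.exists_mem_of_ne_nil (P i).edges fun h =>
    huw (Walk.edges_eq_nil.mp h).eq
  exact ⟨e, (P i).edges_subset_edgeSet he, hmono i e he⟩

theorem SimpleGraph.colorsUsed_add_le_of_cutVertex {V : Type*} [Fintype V] {G : SimpleGraph V}
    {k : ℕ} {c : Sym2 V → ℕ} (hc : G.IsRMCColoring k c) {v x y : V} (hx : x ≠ v) (hy : y ≠ v)
    (hxy : ¬ (G.induce ({v}ᶜ : Set V)).Reachable ⟨x, hx⟩ ⟨y, hy⟩) :
    G.colorsUsed c + k * (Fintype.card V - 2) ≤ G.edgeSet.ncard := by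
  classical
  set R : ℕ → V → Prop := fun i u => (G.colorClass c i).Reachable v u with hR
  set A : Finset V := Finset.univ.filter
    fun u => ∃ h : u ≠ v, (G.induce ({v}ᶜ : Set V)).Reachable ⟨x, hx⟩ ⟨u, h⟩ with hA
  set B : Finset V := Finset.univ.filter fun u => u ≠ v ∧ u ∉ A with hB
  set C : Finset ℕ := G.edgeFinset.image c with hC
  have hxA : x ∈ A := by simp [hA, hx]
  have hyB : y ∈ B := by simp [hB, hA, hy, hxy]
  have hAv : ∀ a ∈ A, a ≠ v := fun a ha => by
    simp only [hA, Finset.mem_filter] at ha; exact ha.2.1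
  have hBv : ∀ b ∈ B, b ≠ v := fun b hb => by
    simp only [hB, Finset.mem_filter] at hb; exact hb.2.1
  have hdisj : Disjoint A B := by
    rw [Finset.disjoint_left]
    intro a ha hb
    simp only [hB, Finset.mem_filter] at hb
    exact hb.2.2 ha
  have hcard : A.card + B.card + 1 = Fintype.card V := by
    have : insert v (A ∪ B) = Finset.univ := by
      ext u
      by_cases h1 : u = v <;> by_cases h2 : u ∈ A <;> simp [hB, h1, h2]
    rw [← Finset.card_univ, ← this, Finset.card_insert_of_notMem, Finset.card_union_of_disjoint hdisj]
    intro h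
    rcases Finset.mem_union.mp h with h | h
    · exact hAv v h rfl
    · exact hBv v h rfl
  have hsep : ∀ a ∈ A, ∀ b ∈ B, k ≤ (C.filter fun i => R i a ∧ R i b).card := by
    intro a ha b hb
    have hne : a ≠ b := fun h => Finset.disjoint_left.mp hdisj ha (h ▸ hb)
    have := hc.le_ncard_separating (v := v) hne fun W => by
      by_contra hW
      have hind : (G.induce ({v}ᶜ : Set V)).Reachable ⟨a, hAv a ha⟩ ⟨b, hBv b hb⟩ :=
        ⟨W.induce ({v}ᶜ : Set V) fun u hu (h : u = v) => hW (h ▸ hu)⟩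
      have hb' := hb
      simp only [hB, Finset.mem_filter] at hb'
      apply hb'.2.2
      simp only [hA, Finset.mem_filter] at ha ⊢
      exact ⟨Finset.mem_univ _, hBv b hb, ha.2.2.trans hind⟩
    rw [← Set.ncard_coe_finset]
    convert this using 2
    ext i
    simp [hC, hR]
  have hfib : ∀ i ∈ C, ((A.erase x).filter fun a => R i a ∧ R i y).card
      + (B.filter fun b => R i x ∧ R i b).card + 1
      ≤ (G.edgeFinset.filter fun e => c e = i).card := by
    intro i hi
    have hedge : (G.colorClass c i).edgeSet.ncard
        = (G.edgeFinset.filter fun e => c e = i).card := by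
      rw [edgeSet_colorClass, ← Set.ncard_coe_finset]
      congr 1
      ext e
      simp
    have hreach : ((A.filter (R i)).card + (B.filter (R i)).card)
        ≤ (G.edgeFinset.filter fun e => c e = i).card := by
      rw [← hedge, ← Finset.card_union_of_disjoint
        (Finset.disjoint_filter_filter hdisj), ← Set.ncard_coe_finset]
      refine le_trans (Set.ncard_le_ncard ?_) (ncard_reachable_le_ncard_edgeSet _ v)
      intro u hu
      simp only [Finset.coe_union, Finset.coe_filter, Set.mem_union, Set.mem_ofPred_eq] at hu
      rcases hu with ⟨h, h'⟩ | ⟨h, h'⟩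
      · exact ⟨hAv u h, h'⟩
      · exact ⟨hBv u h, h'⟩
    have hpos : 1 ≤ (G.edgeFinset.filter fun e => c e = i).card := by
      obtain ⟨e, he, hei⟩ := Finset.mem_image.mp hi
      exact Finset.card_pos.mpr ⟨e, Finset.mem_filter.mpr ⟨he, hei⟩⟩
    by_cases h1 : R i x <;> by_cases h2 : R i y
    · have h3 : (A.erase x).filter (R i) = (A.filter (R i)).erase x := by
        ext u; simp [and_assoc]
      have h4 := Finset.card_erase_add_one (Finset.mem_filter.mpr ⟨hxA, h1⟩ : x ∈ A.filter (R i))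
      simp only [h1, h2, and_true, true_and]
      change ((A.erase x).filter (R i)).card + (B.filter (R i)).card + 1 ≤ _
      rw [h3]
      omega
    · have h4 := Finset.card_pos.mpr ⟨x, (Finset.mem_filter.mpr ⟨hxA, h1⟩ : x ∈ A.filter (R i))⟩
      simp only [h1, h2, and_false, true_and, Finset.filter_false, Finset.card_empty]
      change 0 + (B.filter (R i)).card + 1 ≤ _
      omega
    · have h4 := Finset.card_pos.mpr ⟨y, (Finset.mem_filter.mpr ⟨hyB, h2⟩ : y ∈ B.filter (R i))⟩
      have h5 : ((A.erase x).filter (R i)).card ≤ (A.filter (R i)).card :=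
        Finset.card_le_card (Finset.filter_subset_filter _ (Finset.erase_subset _ _))
      simp only [h1, h2, false_and, and_true, Finset.filter_false, Finset.card_empty]
      change ((A.erase x).filter (R i)).card + 0 + 1 ≤ _
      omega
    · simpa [h1, h2] using hpos
  have hsum := Finset.sum_le_sum hfib
  have hm : ∑ i ∈ C, (G.edgeFinset.filter fun e => c e = i).card = G.edgeFinset.card :=
    (Finset.card_eq_sum_card_image c G.edgeFinset).symm
  have hswapA : k * (A.card - 1) ≤
      ∑ i ∈ C, ((A.erase x).filter fun a => R i a ∧ R i y).card := by
    rw [← Finset.card_erase_of_mem hxA, mul_comm, ← smul_eq_mul]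
    refine (Finset.card_nsmul_le_sum (A.erase x) (fun a => (C.filter fun i => R i a ∧ R i y).card)
      k fun a ha => hsep a (Finset.mem_of_mem_erase ha) y hyB).trans_eq ?_
    exact Finset.sum_card_bipartiteAbove_eq_sum_card_bipartiteBelow (fun a i => R i a ∧ R i y)
  have hswapB : k * B.card ≤ ∑ i ∈ C, (B.filter fun b => R i x ∧ R i b).card := by
    rw [mul_comm, ← smul_eq_mul]
    refine (Finset.card_nsmul_le_sum B (fun b => (C.filter fun i => R i x ∧ R i b).card)
      k fun b hb => hsep x hxA b hb).trans_eq ?_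
    exact Finset.sum_card_bipartiteAbove_eq_sum_card_bipartiteBelow (fun b i => R i x ∧ R i b)
  rw [hm, Finset.sum_add_distrib, Finset.sum_add_distrib, Finset.sum_const, smul_eq_mul,
    mul_one] at hsum
  have hused : G.colorsUsed c = C.card := by
    rw [colorsUsed, ← Set.ncard_coe_finset]
    simp [hC]
  have hm' : G.edgeSet.ncard = G.edgeFinset.card := by
    rw [← Set.ncard_coe_finset, coe_edgeFinset]
  have hA1 : 1 ≤ A.card := Finset.card_pos.mpr ⟨x, hxA⟩
  have hsplit : k * (Fintype.card V - 2) = k * (A.card - 1) + k * B.card := by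
    rw [← mul_add]
    congr 1
    omega
  omega

/-- Coloring `k` edge-disjoint spanning trees with one color each, and all other edges with
further distinct colors, is an RMC coloring. -/
theorem SimpleGraph.TauGE.exists_isRMCColoring {V : Type*} [Fintype V] [Nontrivial V]
    {G : SimpleGraph V} {k : ℕ} (htau : G.TauGE k) :
    ∃ c : Sym2 V → ℕ, G.IsRMCColoring k c ∧
      G.edgeSet.ncard - k * (Fintype.card V - 2) ≤ G.colorsUsed c := by
  classical
  obtain ⟨T, hle, htree, hdis⟩ := htau
  let f : Sym2 V ≃ Fin (Fintype.card (Sym2 V)) := Fintype.equivFin (Sym2 V)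
  let c : Sym2 V → ℕ := fun e =>
    if h : ∃ i, e ∈ (T i).edgeSet then (h.choose : ℕ) else k + f e
  have hcT : ∀ i, ∀ e ∈ (T i).edgeSet, c e = i := by
    intro i e he
    have h : ∃ i, e ∈ (T i).edgeSet := ⟨i, he⟩
    have hi : h.choose = i := by
      by_contra hne
      exact Set.disjoint_left.mp (hdis _ _ hne) h.choose_spec he
    simp only [c, dif_pos h, hi]
  set F : Set (Sym2 V) := ⋃ i, (T i).edgeSet with hF
  have hcF : ∀ e, e ∉ F → c e = k + f e := fun e he => by
    simp only [hF, Set.mem_iUnion] at he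
    simp only [c, dif_neg he]
  refine ⟨c, ?_, ?_⟩
  · intro u v huv
    choose Q hQ using fun i => ((htree i).connected.preconnected u v).exists_isPath
    have hedges : ∀ i, ∀ e ∈ ((Q i).mapLe (hle i)).edges, e ∈ (T i).edgeSet := by
      intro i e he
      rw [Walk.edges_mapLe_eq_edges] at he
      exact (Q i).edges_subset_edgeSet he
    refine ⟨fun i => (Q i).mapLe (hle i), fun i => i, fun i => (hQ i).mapLe _,
      fun i e he => hcT i e (hedges i e he), fun i j hij e hei hej => ?_, Fin.val_injective⟩
    exact Set.disjoint_left.mp (hdis i j hij) (hedges i e hei) (hedges j e hej)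
  · have hcardT : ∀ i, (T i).edgeSet.ncard + 1 = Fintype.card V := fun i => by
      have := (htree i).card_edgeFinset
      rwa [← Set.ncard_coe_finset, coe_edgeFinset] at this
    have hFE : F ⊆ G.edgeSet := Set.iUnion_subset fun i => edgeSet_mono (hle i)
    have hFcard : F.ncard ≤ k * (Fintype.card V - 1) := by
      refine (Set.ncard_iUnion_le_of_fintype _).trans ?_
      rw [Finset.sum_congr rfl fun i _ => Nat.eq_sub_of_add_eq (hcardT i)]
      simp
    have hn : 2 ≤ Fintype.card V := Fintype.one_lt_card
    have hsub : c '' (G.edgeSet \ F) ∪ Set.Iio k ⊆ c '' G.edgeSet := by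
      refine Set.union_subset (Set.image_mono Set.sdiff_subset) fun i (hi : i < k) => ?_
      obtain ⟨e, he⟩ := Set.nonempty_of_ncard_ne_zero (s := (T ⟨i, hi⟩).edgeSet)
        (by have := hcardT ⟨i, hi⟩; omega)
      exact ⟨e, edgeSet_mono (hle _) he, hcT _ e he⟩
    have hdj : Disjoint (c '' (G.edgeSet \ F)) (Set.Iio k) := by
      rw [Set.disjoint_left]
      rintro _ ⟨e, he, rfl⟩ (hlt : c e < k)
      rw [hcF e he.2] at hlt
      omega
    have hinj : Set.InjOn c (G.edgeSet \ F) := fun e he e' he' h => by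
      rw [hcF e he.2, hcF e' he'.2] at h
      exact f.injective (Fin.ext (by omega))
    have h1 := Set.ncard_le_ncard hsub ((Set.toFinite G.edgeSet).image c)
    rw [Set.ncard_union_eq hdj (Set.toFinite _) (Set.finite_Iio k), hinj.ncard_image,
      Set.ncard_Iio_nat] at h1
    have h2 := Set.ncard_sdiff_add_ncard_of_subset hFE
    have h3 : k * (Fintype.card V - 1) = k * (Fintype.card V - 2) + k := by
      rw [← Nat.mul_succ]
      congr 1
      omega
    rw [colorsUsed]
    omega

/-- If `τ(G) ≥ k ≥ 2` and `G` has a cut vertex, then `rmc_k(G) = m - k(n-2)`. -/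
theorem rmc_eq_of_cutVertex {V : Type*} [Fintype V] (G : SimpleGraph V) (k : ℕ)
    (hk : 2 ≤ k) (htau : G.TauGE k)
    (hcut : ∃ v : V, ¬ (G.induce ({v}ᶜ : Set V)).Connected) :
    G.rmc k = G.edgeSet.ncard - k * (Fintype.card V - 2) := by
  obtain ⟨v, hv⟩ := hcut
  rcases subsingleton_or_nontrivial V with hV | hV
  · have hG : G.edgeSet = ∅ := by rw [Subsingleton.elim G ⊥, edgeSet_bot]
    have hused : ∀ c : Sym2 V → ℕ, G.colorsUsed c = 0 := fun c => by simp [colorsUsed, hG]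
    rw [hG, Set.ncard_empty, Nat.zero_sub]
    refine IsGreatest.csSup_eq ⟨⟨fun _ => 0, fun u w huw => ?_, hused _⟩, ?_⟩
    · exact absurd (Subsingleton.elim u w) huw
    · rintro _ ⟨c, -, rfl⟩
      exact (hused c).le
  · obtain ⟨x, y, hxy⟩ : ∃ x y, ¬ (G.induce ({v}ᶜ : Set V)).Reachable x y := by
      obtain ⟨w, hw⟩ := exists_ne v
      by_contra! h
      exact hv { preconnected := h, nonempty := ⟨⟨w, hw⟩⟩ }
    obtain ⟨c, hc, hle⟩ := htau.exists_isRMCColoring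
    have hupper : ∀ c : Sym2 V → ℕ, G.IsRMCColoring k c →
        G.colorsUsed c ≤ G.edgeSet.ncard - k * (Fintype.card V - 2) := fun c hc =>
      Nat.le_sub_of_add_le (colorsUsed_add_le_of_cutVertex hc x.2 y.2 hxy)
    refine IsGreatest.csSup_eq ⟨⟨c, hc, (hupper c hc).antisymm hle⟩, ?_⟩
    rintro _ ⟨c', hc', rfl⟩
    exact hupper c' hc'
end
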